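/- There exist absolute constants c > 0 (chosen small enough) and C > 0 (chosen large enough) with the following property. Assume μ ≤ c/(‖X‖κ), ‖L_{X,⊥}ᵀP_{Z_tQ_t}‖ ≤ c/κ, ‖Z_t‖ ≤ 2√‖X‖, ‖Δ_t‖ ≤ cσ_min(X), ‖Z_tQ_{t,⊥}‖ ≤ min{cκ^{−1/2}√(σ_min(X)), 2σ_min(Z_tQ_t)}, ‖Z̃_tᵀZ_tQ_{t,⊥}‖ ≤ √‖X‖ · σ_min(Z_tQ_t), and that Z_tQ_t has rank r. Then ‖L_{X,⊥}ᵀP_{Z_{t+1}Q_{t+1}}‖ ≤ (1 − (1/4)μσ_min(X)) · ‖L_{X,⊥}ᵀP_{Z_tQ_t}‖ + 2μ√‖X‖ · ‖Z̃_tᵀP_{Z_tQ_t}‖ + Cμ√‖X‖ · ‖Z̃_tᵀZ_tQ_{t,⊥}‖/σ_min(Z_tQ_t) + Cμ‖Δ_t‖ + Cμ²‖X‖². -/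

import Mathlib

open Matrix MeasureTheory ProbabilityTheory

noncomputable section

namespace AsymMatrixSensing

/-- Euclidean norm of a real vector. -/
def euclNorm {ι : Type*} [Fintype ι] (v : ι → ℝ) : ℝ :=
  Real.sqrt (∑ i, v i ^ 2)

/-- Spectral norm of a real matrix. -/
def specNorm {ι₁ ι₂ : Type*} [Fintype ι₁] [Fintype ι₂] (M : Matrix ι₁ ι₂ ℝ) : ℝ :=
  sSup {c : ℝ | ∃ x : ι₂ → ℝ, euclNorm x ≤ 1 ∧ c = euclNorm (M.mulVec x)}

/-- Frobenius norm of a real matrix. -/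
def frobNorm {ι₁ ι₂ : Type*} [Fintype ι₁] [Fintype ι₂] (M : Matrix ι₁ ι₂ ℝ) : ℝ :=
  Real.sqrt (∑ i, ∑ j, M i j ^ 2)

/-- Nuclear norm of a real matrix (characterized by duality with the spectral norm). -/
def nucNorm {ι₁ ι₂ : Type*} [Fintype ι₁] [Fintype ι₂] (M : Matrix ι₁ ι₂ ℝ) : ℝ :=
  sSup {c : ℝ | ∃ B : Matrix ι₁ ι₂ ℝ, specNorm B ≤ 1 ∧ c = ∑ i, ∑ j, M i j * B i j}

/-- Smallest singular value `σ_{min(a,b)}(M)` of a matrix. -/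
def sigmaMin {ι₁ ι₂ : Type*} [Fintype ι₁] [Fintype ι₂] (M : Matrix ι₁ ι₂ ℝ) : ℝ :=
  max (sInf {c : ℝ | ∃ x : ι₂ → ℝ, euclNorm x = 1 ∧ c = euclNorm (M.mulVec x)})
      (sInf {c : ℝ | ∃ y : ι₁ → ℝ, euclNorm y = 1 ∧ c = euclNorm (Mᵀ.mulVec y)})

/-- Smallest nonzero singular value `σ_rank(M)`: the minimum of `‖Mx‖` over unit
vectors `x` orthogonal to the kernel of `M`. -/
def sigmaPos {ι₁ ι₂ : Type*} [Fintype ι₁] [Fintype ι₂] (M : Matrix ι₁ ι₂ ℝ) : ℝ :=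
  sInf {c : ℝ | ∃ x : ι₂ → ℝ, euclNorm x = 1 ∧
    (∀ y : ι₂ → ℝ, M.mulVec y = 0 → x ⬝ᵥ y = 0) ∧ c = euclNorm (M.mulVec x)}

/-- Condition number `κ = ‖M‖ / σ_min(M)`. -/
def condNum {ι₁ ι₂ : Type*} [Fintype ι₁] [Fintype ι₂] (M : Matrix ι₁ ι₂ ℝ) : ℝ :=
  specNorm M / sigmaPos M

/-- Trace inner product `⟨M, N⟩ = trace(Mᵀ N)`. -/
def minner {ι₁ ι₂ : Type*} [Fintype ι₁] [Fintype ι₂] (M N : Matrix ι₁ ι₂ ℝ) : ℝ :=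
  ∑ i, ∑ j, M i j * N i j

/-- `P` is a matrix with orthonormal columns spanning the column space of `M`. -/
def IsOrthCol {ι κ₁ κ₂ : Type*} [Fintype ι] [Fintype κ₁] [Fintype κ₂] [DecidableEq κ₂]
    (P : Matrix ι κ₂ ℝ) (M : Matrix ι κ₁ ℝ) : Prop :=
  Pᵀ * P = 1 ∧ (∃ C : Matrix κ₁ κ₂ ℝ, P = M * C) ∧ P * Pᵀ * M = M

/-- `L` has orthonormal columns spanning the subspace spanned by eigenvectors of the
symmetric matrix `F` corresponding to its `r` largest eigenvalues. -/
def IsTopEigenspace {ι : Type*} [Fintype ι] [DecidableEq ι] {r : ℕ} (F : Matrix ι ι ℝ)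
    (L : Matrix ι (Fin r) ℝ) : Prop :=
  Lᵀ * L = 1 ∧ ∃ d : Fin r → ℝ, F * L = L * Matrix.diagonal d ∧
    ∀ (v : ι → ℝ) (lam : ℝ), v ≠ 0 → F.mulVec v = lam • v →
      Lᵀ.mulVec v = 0 → ∀ i, lam ≤ d i

variable {n₁ n₂ m k r : ℕ}

/-- The measurement operator `𝒜`, given by `[𝒜(Z)]ᵢ = ⟨Aᵢ, Z⟩`. -/
def calA (A : Fin m → Matrix (Fin n₁) (Fin n₂) ℝ) (Z : Matrix (Fin n₁) (Fin n₂) ℝ) :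
    Fin m → ℝ := fun i => minner (A i) Z

/-- The restricted isometry property of order `s` with constant `δ`. -/
def HasRIP (A : Fin m → Matrix (Fin n₁) (Fin n₂) ℝ) (s : ℕ) (δ : ℝ) : Prop :=
  ∀ M : Matrix (Fin n₁) (Fin n₂) ℝ, M.rank ≤ s →
    (1 - δ) * frobNorm M ^ 2 ≤ ∑ i, calA A M i ^ 2 ∧
      ∑ i, calA A M i ^ 2 ≤ (1 + δ) * frobNorm M ^ 2

/-- `𝒜*𝒜`. -/
def AstarA (A : Fin m → Matrix (Fin n₁) (Fin n₂) ℝ) (Z : Matrix (Fin n₁) (Fin n₂) ℝ) :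
    Matrix (Fin n₁) (Fin n₂) ℝ := ∑ i, minner (A i) Z • A i

/-- The symmetrization `sym(X) = [[0, X], [Xᵀ, 0]]`. -/
def symMat (X : Matrix (Fin n₁) (Fin n₂) ℝ) :
    Matrix (Fin n₁ ⊕ Fin n₂) (Fin n₁ ⊕ Fin n₂) ℝ := Matrix.fromBlocks 0 X Xᵀ 0

/-- The symmetrized measurement matrices `Bᵢ = (1/√2)[[0, Aᵢ], [Aᵢᵀ, 0]]`. -/
def Bmat (A : Fin m → Matrix (Fin n₁) (Fin n₂) ℝ) (i : Fin m) :
    Matrix (Fin n₁ ⊕ Fin n₂) (Fin n₁ ⊕ Fin n₂) ℝ :=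
  (Real.sqrt 2)⁻¹ • Matrix.fromBlocks 0 (A i) (A i)ᵀ 0

/-- `ℬ*ℬ`. -/
def BstarB (A : Fin m → Matrix (Fin n₁) (Fin n₂) ℝ)
    (S : Matrix (Fin n₁ ⊕ Fin n₂) (Fin n₁ ⊕ Fin n₂) ℝ) :
    Matrix (Fin n₁ ⊕ Fin n₂) (Fin n₁ ⊕ Fin n₂) ℝ :=
  ∑ i, minner (Bmat A i) S • Bmat A i

/-- The factorized gradient descent iterates `(V_t, W_t)`. -/
def iter (A : Fin m → Matrix (Fin n₁) (Fin n₂) ℝ) (X : Matrix (Fin n₁) (Fin n₂) ℝ)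
    (μ : ℝ) (V₀ : Matrix (Fin n₁) (Fin k) ℝ) (W₀ : Matrix (Fin n₂) (Fin k) ℝ) :
    ℕ → Matrix (Fin n₁) (Fin k) ℝ × Matrix (Fin n₂) (Fin k) ℝ
  | 0 => (V₀, W₀)
  | t + 1 =>
    let p := iter A X μ V₀ W₀ t
    let G := AstarA A (p.1 * p.2ᵀ - X)
    (p.1 - μ • (G * p.2), p.2 - μ • (Gᵀ * p.1))

/-- The vertical stacking `(1/√2)[V; W]`. -/
def Zstack {κ : ℕ} (V : Matrix (Fin n₁) (Fin κ) ℝ) (W : Matrix (Fin n₂) (Fin κ) ℝ) :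
    Matrix (Fin n₁ ⊕ Fin n₂) (Fin κ) ℝ :=
  (Real.sqrt 2)⁻¹ • Matrix.fromRows V W

/-- `Z_t = (1/√2)[V_t; W_t]`. -/
def Zit (A : Fin m → Matrix (Fin n₁) (Fin n₂) ℝ) (X : Matrix (Fin n₁) (Fin n₂) ℝ)
    (μ : ℝ) (V₀ : Matrix (Fin n₁) (Fin k) ℝ) (W₀ : Matrix (Fin n₂) (Fin k) ℝ) (t : ℕ) :
    Matrix (Fin n₁ ⊕ Fin n₂) (Fin k) ℝ :=
  Zstack (iter A X μ V₀ W₀ t).1 (iter A X μ V₀ W₀ t).2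

/-- `Z̃_t = (1/√2)[V_t; −W_t]`. -/
def Ztil (A : Fin m → Matrix (Fin n₁) (Fin n₂) ℝ) (X : Matrix (Fin n₁) (Fin n₂) ℝ)
    (μ : ℝ) (V₀ : Matrix (Fin n₁) (Fin k) ℝ) (W₀ : Matrix (Fin n₂) (Fin k) ℝ) (t : ℕ) :
    Matrix (Fin n₁ ⊕ Fin n₂) (Fin k) ℝ :=
  Zstack (iter A X μ V₀ W₀ t).1 (-(iter A X μ V₀ W₀ t).2)

/-- `Δ_t = (Id − ℬ*ℬ)(Z_tZ_tᵀ − Z̃_tZ̃_tᵀ − sym(X))`. -/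
def Δit (A : Fin m → Matrix (Fin n₁) (Fin n₂) ℝ) (X : Matrix (Fin n₁) (Fin n₂) ℝ)
    (μ : ℝ) (V₀ : Matrix (Fin n₁) (Fin k) ℝ) (W₀ : Matrix (Fin n₂) (Fin k) ℝ) (t : ℕ) :
    Matrix (Fin n₁ ⊕ Fin n₂) (Fin n₁ ⊕ Fin n₂) ℝ :=
  let D := Zit A X μ V₀ W₀ t * (Zit A X μ V₀ W₀ t)ᵀ
    - Ztil A X μ V₀ W₀ t * (Ztil A X μ V₀ W₀ t)ᵀ - symMat X
  D - BstarB A D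

/-- The block diagonal matrix `diag(Id_{n₁}, −Id_{n₂})`. -/
def flipSign (n₁ n₂ : ℕ) : Matrix (Fin n₁ ⊕ Fin n₂) (Fin n₁ ⊕ Fin n₂) ℝ :=
  Matrix.fromBlocks 1 0 0 (-1)

/-- Product Gaussian measure modelling the random initialization pair `(V, W)`
with i.i.d. standard Gaussian entries. -/
def gaussPair (n₁ n₂ k : ℕ) :
    Measure ((Fin n₁ → Fin k → ℝ) × (Fin n₂ → Fin k → ℝ)) :=
  (Measure.pi fun _ : Fin n₁ => Measure.pi fun _ : Fin k => gaussianReal 0 1).prod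
    (Measure.pi fun _ : Fin n₂ => Measure.pi fun _ : Fin k => gaussianReal 0 1)

section helpers
open scoped Matrix.Norms.L2Operator

theorem euclNorm_eq {ι : Type*} [Fintype ι] (v : ι → ℝ) :
    euclNorm v = ‖(WithLp.toLp 2 v : EuclideanSpace ℝ ι)‖ := by
  rw [EuclideanSpace.norm_eq]
  simp [euclNorm]

theorem euclNorm_mulVec_le {ι₁ ι₂ : Type*} [Fintype ι₁] [Fintype ι₂] [DecidableEq ι₂]
    (M : Matrix ι₁ ι₂ ℝ) (x : ι₂ → ℝ) :
    euclNorm (M.mulVec x) ≤ ‖M‖ * euclNorm x := by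
  rw [euclNorm_eq, euclNorm_eq]
  exact Matrix.l2_opNorm_mulVec M (WithLp.toLp 2 x)

theorem euclNorm_smul {ι : Type*} [Fintype ι] (a : ℝ) (v : ι → ℝ) :
    euclNorm (a • v) = |a| * euclNorm v := by
  rw [euclNorm_eq, euclNorm_eq, WithLp.toLp_smul, norm_smul, Real.norm_eq_abs]

theorem euclNorm_nonneg {ι : Type*} [Fintype ι] (v : ι → ℝ) : 0 ≤ euclNorm v :=
  Real.sqrt_nonneg _

theorem euclNorm_sq {ι : Type*} [Fintype ι] (v : ι → ℝ) : euclNorm v ^ 2 = v ⬝ᵥ v := by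
  rw [euclNorm, Real.sq_sqrt (Finset.sum_nonneg fun i _ => sq_nonneg _)]
  simp [dotProduct, sq]

theorem norm_le_of_vec {ι₁ ι₂ : Type*} [Fintype ι₁] [Fintype ι₂] [DecidableEq ι₂]
    (M : Matrix ι₁ ι₂ ℝ) (c : ℝ) (hc : 0 ≤ c)
    (h : ∀ x, euclNorm (M.mulVec x) ≤ c * euclNorm x) : ‖M‖ ≤ c := by
  rw [Matrix.l2_opNorm_def]
  refine ContinuousLinearMap.opNorm_le_bound _ hc fun x => ?_
  have := h x.ofLp
  rw [euclNorm_eq, euclNorm_eq] at this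
  exact this

theorem specNorm_bdd {ι₁ ι₂ : Type*} [Fintype ι₁] [Fintype ι₂] [DecidableEq ι₂]
    (M : Matrix ι₁ ι₂ ℝ) :
    BddAbove {c : ℝ | ∃ x : ι₂ → ℝ, euclNorm x ≤ 1 ∧ c = euclNorm (M.mulVec x)} := by
  refine ⟨‖M‖, ?_⟩
  rintro c ⟨x, hx, rfl⟩
  calc _ ≤ ‖M‖ * euclNorm x := euclNorm_mulVec_le M x
    _ ≤ ‖M‖ * 1 := by gcongr
    _ = ‖M‖ := mul_one _

theorem euclNorm_zero {ι : Type*} [Fintype ι] : euclNorm (0 : ι → ℝ) = 0 := by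
  simp [euclNorm]

theorem euclNorm_eq_zero {ι : Type*} [Fintype ι] {v : ι → ℝ} (h : euclNorm v = 0) : v = 0 := by
  have h2 := euclNorm_sq v
  rw [h] at h2
  exact dotProduct_self_eq_zero.1 (by rw [← h2]; norm_num)

theorem specNorm_eq {ι₁ ι₂ : Type*} [Fintype ι₁] [Fintype ι₂] [DecidableEq ι₂]
    (M : Matrix ι₁ ι₂ ℝ) : specNorm M = ‖M‖ := by
  apply le_antisymm
  · apply csSup_le
    · exact ⟨_, 0, by rw [euclNorm_zero]; norm_num, rfl⟩
    · rintro c ⟨x, hx, rfl⟩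
      calc _ ≤ ‖M‖ * euclNorm x := euclNorm_mulVec_le M x
        _ ≤ ‖M‖ * 1 := by gcongr
        _ = ‖M‖ := mul_one _
  · apply norm_le_of_vec
    · exact le_csSup (specNorm_bdd M) ⟨0, by rw [euclNorm_zero]; norm_num, by
        rw [Matrix.mulVec_zero, euclNorm_zero]⟩
    · intro x
      by_cases hx : euclNorm x = 0
      · rw [euclNorm_eq_zero hx]
        simp [euclNorm_zero]
      · have hpos : 0 < euclNorm x := lt_of_le_of_ne (euclNorm_nonneg x) (Ne.symm hx)
        have h1 : euclNorm (M.mulVec ((euclNorm x)⁻¹ • x)) ≤ specNorm M := by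
          apply le_csSup (specNorm_bdd M)
          refine ⟨_, ?_, rfl⟩
          rw [euclNorm_smul, abs_of_pos (inv_pos.2 hpos), inv_mul_cancel₀ hx]
        rw [Matrix.mulVec_smul, euclNorm_smul, abs_of_pos (inv_pos.2 hpos),
          inv_mul_le_iff₀ hpos] at h1
        linarith

theorem norm_tr {ι₁ ι₂ : Type*} [Fintype ι₁] [Fintype ι₂] [DecidableEq ι₁] [DecidableEq ι₂]
    (M : Matrix ι₁ ι₂ ℝ) : ‖Mᵀ‖ = ‖M‖ := by
  have := Matrix.l2_opNorm_conjTranspose M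
  rwa [Matrix.conjTranspose_eq_transpose_of_trivial] at this

theorem norm_tr_mul_self {ι₁ ι₂ : Type*} [Fintype ι₁] [Fintype ι₂] [DecidableEq ι₁]
    [DecidableEq ι₂] (M : Matrix ι₁ ι₂ ℝ) : ‖Mᵀ * M‖ = ‖M‖ * ‖M‖ := by
  have := Matrix.l2_opNorm_conjTranspose_mul_self M
  rwa [Matrix.conjTranspose_eq_transpose_of_trivial] at this

theorem norm_one_le' {ι : Type*} [Fintype ι] [DecidableEq ι] : ‖(1 : Matrix ι ι ℝ)‖ ≤ 1 := by
  apply norm_le_of_vec _ _ zero_le_one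
  intro x
  simp

theorem norm_orth {ι₁ ι₂ : Type*} [Fintype ι₁] [Fintype ι₂] [DecidableEq ι₁]
    [DecidableEq ι₂] (M : Matrix ι₁ ι₂ ℝ) (h : Mᵀ * M = 1) : ‖M‖ ≤ 1 := by
  have h1 := norm_tr_mul_self M
  rw [h] at h1
  have := norm_one_le' (ι := ι₂)
  nlinarith [norm_nonneg M]

theorem norm_orth_tr {ι₁ ι₂ : Type*} [Fintype ι₁] [Fintype ι₂] [DecidableEq ι₁]
    [DecidableEq ι₂] (M : Matrix ι₁ ι₂ ℝ) (h : Mᵀ * M = 1) : ‖Mᵀ‖ ≤ 1 := by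
  rw [norm_tr]; exact norm_orth M h

theorem norm_proj {ι₁ ι₂ : Type*} [Fintype ι₁] [Fintype ι₂] [DecidableEq ι₁]
    [DecidableEq ι₂] (M : Matrix ι₁ ι₂ ℝ) (h : Mᵀ * M = 1) : ‖1 - M * Mᵀ‖ ≤ 1 := by
  have h1 := norm_tr_mul_self (1 - M * Mᵀ)
  have h2 : (1 - M * Mᵀ)ᵀ * (1 - M * Mᵀ) = 1 - M * Mᵀ := by
    simp only [Matrix.transpose_sub, Matrix.transpose_mul, Matrix.transpose_transpose,
      Matrix.transpose_one, Matrix.mul_sub, Matrix.sub_mul, Matrix.mul_one, Matrix.one_mul]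
    have : M * Mᵀ * (M * Mᵀ) = M * Mᵀ := by
      rw [Matrix.mul_assoc, ← Matrix.mul_assoc Mᵀ, h, Matrix.one_mul]
    rw [this]; abel
  rw [h2] at h1
  by_contra hcon
  push Not at hcon
  nlinarith [norm_nonneg (1 - M * Mᵀ)]

/-- completeness of a pair of complementary orthonormal families -/
theorem complete_of_card {ι a b : Type*} [Fintype ι] [Fintype a] [Fintype b] [DecidableEq ι]
    [DecidableEq a] [DecidableEq b] (U : Matrix ι a ℝ) (V : Matrix ι b ℝ)
    (hU : Uᵀ * U = 1) (hV : Vᵀ * V = 1) (hUV : Uᵀ * V = 0)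
    (hc : Fintype.card a + Fintype.card b = Fintype.card ι) : U * Uᵀ + V * Vᵀ = 1 := by
  have hVU : Vᵀ * U = 0 := by
    have := congrArg Matrix.transpose hUV
    simpa using this
  have h1 : Matrix.fromRows Uᵀ Vᵀ * Matrix.fromCols U V = 1 := by
    rw [Matrix.fromRows_mul_fromCols, hU, hV, hUV, hVU, Matrix.fromBlocks_one]
  have h2 : Matrix.fromCols U V * Matrix.fromRows Uᵀ Vᵀ = 1 := by
    refine (Matrix.mul_eq_one_comm_of_card_eq _ _ _ ?_).1 h1
    simp [hc]
  rwa [Matrix.fromCols_mul_fromRows] at h2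

theorem card_le_of_orth {ι a : Type*} [Fintype ι] [Fintype a] [DecidableEq ι]
    [DecidableEq a] (U : Matrix ι a ℝ) (hU : Uᵀ * U = 1) : Fintype.card a ≤ Fintype.card ι := by
  have h1 : (Uᵀ * U).rank = Fintype.card a := by rw [hU, Matrix.rank_one]
  have h2 := Matrix.rank_mul_le_right Uᵀ U
  have h3 := Matrix.rank_le_card_height U
  omega

theorem norm_one_sub_le {ι : Type*} [Fintype ι] [DecidableEq ι] (A : Matrix ι ι ℝ)
    (a B μ : ℝ) (hμ : 0 ≤ μ) (hμa : μ * a ≤ 1) (hA : ‖A‖ ≤ B)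
    (h : ∀ x : ι → ℝ, a * (x ⬝ᵥ x) ≤ x ⬝ᵥ (A.mulVec x)) :
    ‖1 - μ • A‖ ≤ 1 - μ * a + μ ^ 2 * B ^ 2 / 2 := by
  have hB : 0 ≤ B := (norm_nonneg _).trans hA
  have hR : 0 ≤ 1 - μ * a + μ ^ 2 * B ^ 2 / 2 := by nlinarith [sq_nonneg (μ * B)]
  apply norm_le_of_vec _ _ hR
  intro x
  apply le_of_sq_le_sq _ (mul_nonneg hR (euclNorm_nonneg x))
  rw [mul_pow, euclNorm_sq, Matrix.sub_mulVec, Matrix.one_mulVec, Matrix.smul_mulVec]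
  have e1 : (x - μ • A.mulVec x) ⬝ᵥ (x - μ • A.mulVec x)
      = x ⬝ᵥ x - 2 * μ * (x ⬝ᵥ A.mulVec x) + μ ^ 2 * (A.mulVec x ⬝ᵥ A.mulVec x) := by
    simp only [sub_dotProduct, dotProduct_sub, smul_dotProduct, dotProduct_smul, smul_eq_mul]
    rw [dotProduct_comm (A.mulVec x) x]; ring
  rw [e1, ← euclNorm_sq (A.mulVec x), euclNorm_sq x]
  have e2 : euclNorm (A.mulVec x) ^ 2 ≤ B ^ 2 * (x ⬝ᵥ x) := by
    rw [← euclNorm_sq x, ← mul_pow]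
    refine pow_le_pow_left₀ (euclNorm_nonneg _) ((euclNorm_mulVec_le A x).trans ?_) 2
    gcongr
    exact euclNorm_nonneg x
  have hx : 0 ≤ x ⬝ᵥ x := by rw [← euclNorm_sq]; positivity
  have h3 : μ ^ 2 * euclNorm (A.mulVec x) ^ 2 ≤ μ ^ 2 * (B ^ 2 * (x ⬝ᵥ x)) := by gcongr
  have h4 : μ * (a * (x ⬝ᵥ x)) ≤ μ * (x ⬝ᵥ A.mulVec x) := by gcongr; exact h x
  have h5 : 1 - 2 * (μ * a) + μ ^ 2 * B ^ 2 ≤ (1 - μ * a + μ ^ 2 * B ^ 2 / 2) ^ 2 := by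
    nlinarith [sq_nonneg (-(μ * a) + μ ^ 2 * B ^ 2 / 2)]
  have h6 := mul_le_mul_of_nonneg_right h5 hx
  nlinarith

theorem nmul {a b c : Type*} [Fintype a] [Fintype b] [Fintype c] [DecidableEq b] [DecidableEq c]
    {A : Matrix a b ℝ} {B : Matrix b c ℝ} {x y : ℝ} (hA : ‖A‖ ≤ x) (hB : ‖B‖ ≤ y) :
    ‖A * B‖ ≤ x * y :=
  (Matrix.l2_opNorm_mul A B).trans
    (mul_le_mul hA hB (norm_nonneg _) ((norm_nonneg _).trans hA))

theorem nsmul' {a b : Type*} [Fintype a] [Fintype b] [DecidableEq b]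
    {A : Matrix a b ℝ} {x μ : ℝ} (hμ : 0 ≤ μ) (hA : ‖A‖ ≤ x) :
    ‖μ • A‖ ≤ μ * x := by
  rw [norm_smul, Real.norm_eq_abs, abs_of_nonneg hμ]; gcongr

theorem nadd {a b : Type*} [Fintype a] [Fintype b] [DecidableEq b]
    {A B : Matrix a b ℝ} {x y : ℝ} (hA : ‖A‖ ≤ x) (hB : ‖B‖ ≤ y) :
    ‖A + B‖ ≤ x + y := (norm_add_le _ _).trans (add_le_add hA hB)

theorem nsub {a b : Type*} [Fintype a] [Fintype b] [DecidableEq b]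
    {A B : Matrix a b ℝ} {x y : ℝ} (hA : ‖A‖ ≤ x) (hB : ‖B‖ ≤ y) :
    ‖A - B‖ ≤ x + y := (norm_sub_le _ _).trans (add_le_add hA hB)

theorem ntr {a b : Type*} [Fintype a] [Fintype b] [DecidableEq a] [DecidableEq b]
    {A : Matrix a b ℝ} {x : ℝ} (hA : ‖A‖ ≤ x) : ‖Aᵀ‖ ≤ x := by rwa [norm_tr]

theorem T_inv {n r p : Type*} [Fintype n] [Fintype r] [Fintype p] [DecidableEq n] [DecidableEq r]
    [DecidableEq p] (L P : Matrix n r ℝ) (Lp : Matrix n p ℝ) (G : Matrix n n ℝ)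
    (hL : Lᵀ * L = 1) (hLL : L * Lᵀ + Lp * Lpᵀ = 1) (hP : Pᵀ * P = 1)
    (μ g θ : ℝ) (hμ : 0 ≤ μ) (hg : ‖G‖ ≤ g) (hθ : ‖Lpᵀ * P‖ ≤ θ)
    (hsm : θ ^ 2 + μ * g ≤ 1 / 2) :
    ∃ Ti : Matrix r r ℝ, Ti * (Lᵀ * (P + μ • (G * P))) = 1 ∧ (Lᵀ * (P + μ • (G * P))) * Ti = 1 ∧
      ‖Ti‖ ≤ 2 := by
  set T := Lᵀ * (P + μ • (G * P)) with hT
  set B := (Lpᵀ * P)ᵀ * (Lpᵀ * P) - μ • (Pᵀ * (L * (Lᵀ * (G * P)))) with hB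
  have hBn : ‖B‖ ≤ 1 / 2 := by
    have h1 : ‖B‖ ≤ θ * θ + μ * (1 * (1 * (1 * (g * 1)))) :=
      nsub (nmul (ntr hθ) hθ) (nsmul' hμ (nmul (norm_orth_tr P hP) (nmul (norm_orth L hL)
        (nmul (norm_orth_tr L hL) (nmul hg (norm_orth P hP))))))
    nlinarith
  have hPLT : (Pᵀ * L) * T = 1 - B := by
    have h1 : Pᵀ * (L * (Lᵀ * P)) + Pᵀ * (Lp * (Lpᵀ * P)) = 1 := by
      rw [← hP, ← Matrix.mul_add, ← Matrix.mul_assoc L, ← Matrix.mul_assoc Lp, ← Matrix.add_mul,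
        hLL, Matrix.one_mul]
    rw [hT, hB, ← h1]
    simp only [Matrix.mul_add, Matrix.mul_smul, Matrix.transpose_mul, Matrix.transpose_transpose,
      Matrix.mul_assoc]
    abel
  obtain ⟨u, hu⟩ := isUnit_one_sub_of_norm_lt_one (lt_of_le_of_lt hBn (by norm_num))
  have hV : (↑u⁻¹ : Matrix r r ℝ) * (1 - B) = 1 := by rw [← hu]; exact u.inv_mul
  set V : Matrix r r ℝ := ↑u⁻¹
  have hVn : ‖V‖ ≤ 2 := by
    have h1 : V = 1 + V * B := by rw [← hV]; noncomm_ring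
    have h2 : ‖V‖ ≤ 1 + ‖V‖ * (1 / 2) := by
      conv_lhs => rw [h1]
      exact nadd norm_one_le' (nmul le_rfl hBn)
    linarith
  have hl : (V * (Pᵀ * L)) * T = 1 := by rw [Matrix.mul_assoc, hPLT, hV]
  refine ⟨V * (Pᵀ * L), hl, mul_eq_one_comm.1 hl, ?_⟩
  have := nmul hVn (nmul (norm_orth_tr P hP) (norm_orth L hL))
  linarith

theorem J_bound {n r p q k : Type*} [Fintype n] [Fintype r] [Fintype p] [Fintype q] [Fintype k]
    [DecidableEq n] [DecidableEq r] [DecidableEq p] [DecidableEq q] [DecidableEq k]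
    (L Lt P : Matrix n r ℝ) (Lp : Matrix n p ℝ) (G D : Matrix n n ℝ) (E : Matrix n q ℝ)
    (Zt : Matrix n k ℝ) (Sg S Si Ti : Matrix r r ℝ)
    (hL : Lᵀ * L = 1) (hLL : L * Lᵀ + Lp * Lpᵀ = 1) (hP : Pᵀ * P = 1)
    (hLp : Lpᵀ * Lp = 1)
    (hLLt : Lᵀ * Lt = 0) (hLE : Lᵀ * E = 0) (hSi : Si * S = 1)
    (μ g θ e d z ζ ss si : ℝ) (hμ : 0 ≤ μ) (hg : ‖G‖ ≤ g) (hθ : ‖Lpᵀ * P‖ ≤ θ)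
    (hE : ‖E‖ ≤ e) (hD : ‖D‖ ≤ d) (hZ : ‖Zt‖ ≤ z) (hζ : ‖Ztᵀ * E‖ ≤ ζ) (hS : ‖S‖ ≤ ss)
    (hSin : ‖Si‖ ≤ si)
    (hG : G = L * Sg * Lᵀ - Lt * Sg * Ltᵀ - (P * S * Sᵀ * Pᵀ + E * Eᵀ) + Zt * Ztᵀ + D)
    (hT1 : Ti * (Lᵀ * (P + μ • (G * P))) = 1) (hTn : ‖Ti‖ ≤ 2) :
    ‖(Si * Ti * (Lᵀ * (E + μ • (G * E))))ᵀ‖ ≤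
      μ * (ss * (θ * e) + μ * (si * (2 * (g * (ss * (ss * (θ * e))))))
        + si * (2 * (z * ζ + d * e))) := by
  have hPE : ‖Pᵀ * E‖ ≤ θ * e := by
    have h1 : Pᵀ * E = (Lpᵀ * P)ᵀ * (Lpᵀ * E) := by
      have : E = L * (Lᵀ * E) + Lp * (Lpᵀ * E) := by
        rw [← Matrix.mul_assoc, ← Matrix.mul_assoc, ← Matrix.add_mul, hLL, Matrix.one_mul]
      conv_lhs => rw [this, hLE]
      simp only [Matrix.mul_zero, zero_add, Matrix.transpose_mul, Matrix.transpose_transpose,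
        Matrix.mul_assoc]
    rw [h1]
    have := nmul (ntr hθ) (nmul (norm_orth_tr Lp hLp) hE)
    rwa [one_mul] at this
  have hGE : Lᵀ * (G * E) = - (Lᵀ * (P * (S * (Sᵀ * (Pᵀ * E))))) + Lᵀ * (Zt * (Ztᵀ * E))
      + Lᵀ * (D * E) := by
    have hLE' : ∀ (Y : Matrix q q ℝ), Lᵀ * (E * Y) = 0 := by
      intro Y
      rw [← Matrix.mul_assoc, hLE, Matrix.zero_mul]
    have hLLt' : ∀ (Y : Matrix r q ℝ), Lᵀ * (Lt * Y) = 0 := by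
      intro Y
      rw [← Matrix.mul_assoc, hLLt, Matrix.zero_mul]
    rw [hG]
    simp only [Matrix.add_mul, Matrix.sub_mul, Matrix.mul_add, Matrix.mul_sub, Matrix.mul_assoc,
      hLE, hLE', hLLt', Matrix.mul_zero]
    abel
  have hTP : Ti * (Lᵀ * P) = 1 - μ • (Ti * (Lᵀ * (G * P))) := by
    rw [← hT1]
    simp only [Matrix.mul_add, Matrix.mul_smul]
    abel
  have key : Si * Ti * (Lᵀ * (E + μ • (G * E))) =
      μ • (-(Sᵀ * (Pᵀ * E)) + μ • (Si * (Ti * (Lᵀ * (G * (P * (S * (Sᵀ * (Pᵀ * E))))))))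
        + Si * (Ti * (Lᵀ * (Zt * (Ztᵀ * E) + D * E)))) := by
    rw [Matrix.mul_add, hLE, zero_add, Matrix.mul_smul, Matrix.mul_smul, hGE]
    congr 1
    have h1 : Si * (Ti * (Lᵀ * (P * (S * (Sᵀ * (Pᵀ * E)))))) = Sᵀ * (Pᵀ * E) -
        μ • (Si * (Ti * (Lᵀ * (G * (P * (S * (Sᵀ * (Pᵀ * E)))))))) := by
      have h2 : Si * (Ti * (Lᵀ * (P * (S * (Sᵀ * (Pᵀ * E)))))) =
          Si * ((Ti * (Lᵀ * P)) * (S * (Sᵀ * (Pᵀ * E)))) := by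
        simp only [Matrix.mul_assoc]
      have h3 : Si * (S * (Sᵀ * (Pᵀ * E))) = Sᵀ * (Pᵀ * E) := by
        rw [← Matrix.mul_assoc, hSi, Matrix.one_mul]
      rw [h2, hTP, Matrix.sub_mul, Matrix.one_mul, Matrix.mul_sub, h3]
      simp only [Matrix.smul_mul, Matrix.mul_smul, Matrix.mul_assoc]
    simp only [Matrix.mul_add, Matrix.mul_neg, Matrix.mul_assoc]
    rw [h1]
    abel
  rw [norm_tr, key]
  have hz0 : 0 ≤ z := (norm_nonneg _).trans hZ
  have hSt := ntr hS
  have hX1 : ‖Sᵀ * (Pᵀ * E)‖ ≤ ss * (θ * e) := nmul hSt hPE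
  apply nsmul' hμ
  apply nadd
  · apply nadd
    · rw [norm_neg]; exact hX1
    · apply nsmul' hμ
      apply nmul hSin
      apply nmul hTn
      have := nmul (norm_orth_tr L hL) (nmul hg (nmul (norm_orth P hP) (nmul hS hX1)))
      simpa only [one_mul] using this
  · apply nmul hSin
    apply nmul hTn
    have := nmul (norm_orth_tr L hL) (nadd (nmul hZ hζ) (nmul hD hE))
    simpa only [one_mul] using this

theorem dot_gram {a b : Type*} [Fintype a] [Fintype b] (B : Matrix a b ℝ) (y : b → ℝ) :
    y ⬝ᵥ (Bᵀ * B).mulVec y = B.mulVec y ⬝ᵥ B.mulVec y := by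
  rw [← Matrix.mulVec_mulVec, Matrix.dotProduct_mulVec, Matrix.vecMul_transpose]

theorem final_bound {n r p q k : Type*} [Fintype n] [Fintype r] [Fintype p] [Fintype q] [Fintype k]
    [DecidableEq n] [DecidableEq r] [DecidableEq p] [DecidableEq q] [DecidableEq k]
    (L Lt P K Ps : Matrix n r ℝ) (Lp : Matrix n p ℝ) (G D : Matrix n n ℝ) (E : Matrix n q ℝ)
    (Zt : Matrix n k ℝ) (S W : Matrix r r ℝ) (sv : r → ℝ)
    (hL : Lᵀ * L = 1) (hLL : L * Lᵀ + Lp * Lpᵀ = 1) (hP : Pᵀ * P = 1)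
    (hLp : Lpᵀ * Lp = 1) (hLtt : Ltᵀ * Lt = 1)
    (hLLt : Lᵀ * Lt = 0) (hLLp : Lᵀ * Lp = 0) (hLE : Lᵀ * E = 0)
    (μ g θ e d z τ kk ω δ x σ : ℝ) (hμ : 0 ≤ μ) (hg : ‖G‖ ≤ g) (hθ : ‖Lpᵀ * P‖ ≤ θ)
    (hE : ‖E‖ ≤ e) (hD : ‖D‖ ≤ d) (hZ : ‖Zt‖ ≤ z) (hτ : ‖Ztᵀ * P‖ ≤ τ)
    (hK : ‖K‖ ≤ kk) (hW : ‖W‖ ≤ ω) (hδ : ‖Pᵀ * Ps - W‖ ≤ δ) (hPs : ‖Ps‖ ≤ 1)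
    (hx : ‖Matrix.diagonal sv‖ ≤ x) (hσ : ∀ i, σ ≤ sv i) (hσ0 : 0 ≤ σ) (hμσ : μ * σ ≤ 1)
    (hG : G = L * Matrix.diagonal sv * Lᵀ - Lt * Matrix.diagonal sv * Ltᵀ
      - (P * S * Sᵀ * Pᵀ + E * Eᵀ) + Zt * Ztᵀ + D)
    (hF : Ps = (P + K + μ • (G * (P + K))) * W) :
    ‖Lpᵀ * Ps‖ ≤ (1 + μ ^ 2 * x ^ 2 / 2) *
        (θ * ((1 - μ * (σ * (1 - θ ^ 2)) + μ ^ 2 * x ^ 2 / 2) * 1))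
      + μ ^ 2 * (x * (θ * x)) + μ * ((θ * x + x * θ) * δ) + μ * (θ * (θ * (x * (θ * ω))))
      + μ * (e * (θ * e * ω)) + μ * (z * (τ * ω)) + μ * (d * ω) + (kk * ω + μ * (g * (kk * ω))) := by
  have hx0 : 0 ≤ x := (norm_nonneg _).trans hx
  have hθ0 : 0 ≤ θ := (norm_nonneg _).trans hθ
  set Sg := Matrix.diagonal sv with hSg
  set R := Ltᵀ * Lp with hR
  set Θ := Lpᵀ * P with hΘ
  set H := Lᵀ * P with hH
  set Y := Pᵀ * Ps with hY
  set Λ := 1 - P * Pᵀ with hΛ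
  have hRn : ‖R‖ ≤ 1 := by
    have := nmul (norm_orth_tr Lt hLtt) (norm_orth Lp hLp)
    rwa [one_mul] at this
  have hHn : ‖H‖ ≤ 1 := by
    have := nmul (norm_orth_tr L hL) (norm_orth P hP)
    rwa [one_mul] at this
  have hYn : ‖Y‖ ≤ 1 := by
    have := nmul (norm_orth_tr P hP) hPs
    rwa [one_mul] at this
  have hΛn : ‖Λ‖ ≤ 1 := norm_proj P hP
  have hLpΛ : ‖Lpᵀ * Λ‖ ≤ 1 := by
    have := nmul (norm_orth_tr Lp hLp) hΛn
    rwa [one_mul] at this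
  have hLtL : Ltᵀ * L = 0 := by
    have := congrArg Matrix.transpose hLLt
    simpa using this
  have hLpL : Lpᵀ * L = 0 := by
    have := congrArg Matrix.transpose hLLp
    simpa using this
  have hEL : Eᵀ * L = 0 := by
    have := congrArg Matrix.transpose hLE
    simpa using this
  have hPdec : P = L * H + Lp * Θ := by
    rw [hH, hΘ, ← Matrix.mul_assoc, ← Matrix.mul_assoc, ← Matrix.add_mul, hLL, Matrix.one_mul]
  have hLtP : Ltᵀ * P = R * Θ := by
    conv_lhs => rw [hPdec]
    rw [Matrix.mul_add, ← Matrix.mul_assoc, hLtL, Matrix.zero_mul, zero_add, ← Matrix.mul_assoc]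
  have hLtPn : ‖Ltᵀ * P‖ ≤ θ := by
    rw [hLtP]
    have := nmul hRn hθ
    rwa [one_mul] at this
  have hPLtn : ‖Pᵀ * Lt‖ ≤ θ := by
    have := ntr hLtPn
    simpa [Matrix.transpose_mul] using this
  have hEPn : ‖Eᵀ * P‖ ≤ θ * e := by
    have h1 : Eᵀ * P = (Lpᵀ * E)ᵀ * Θ := by
      conv_lhs => rw [hPdec]
      rw [Matrix.mul_add, ← Matrix.mul_assoc, hEL, Matrix.zero_mul, zero_add, ← Matrix.mul_assoc]
      simp [Matrix.transpose_mul]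
    rw [h1]
    have := nmul (ntr (nmul (norm_orth_tr Lp hLp) hE)) hθ
    linarith
  set N := Rᵀ * (Sg * R) with hN
  set A := Hᵀ * (Sg * H) with hA
  have hNn : ‖N‖ ≤ x := by
    have := nmul (ntr hRn) (nmul hx hRn)
    linarith
  have hAn : ‖A‖ ≤ x := by
    have := nmul (ntr hHn) (nmul hx hHn)
    linarith
  have hquad : ∀ y : r → ℝ, σ * (y ⬝ᵥ y) ≤ y ⬝ᵥ Sg.mulVec y := by
    intro y
    simp only [hSg, dotProduct, Matrix.mulVec_diagonal, Finset.mul_sum]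
    apply Finset.sum_le_sum
    intro i _
    nlinarith [hσ i, mul_self_nonneg (y i)]
  have hdp : ∀ y : r → ℝ, 0 ≤ y ⬝ᵥ y := fun y => by rw [← euclNorm_sq]; positivity
  have hN1 : ‖1 - μ • N‖ ≤ 1 + μ ^ 2 * x ^ 2 / 2 := by
    have := norm_one_sub_le N 0 x μ hμ (by simp) hNn (by
      intro y
      have h1 := hquad (R.mulVec y)
      have h2 : y ⬝ᵥ N.mulVec y = R.mulVec y ⬝ᵥ Sg.mulVec (R.mulVec y) := by
        rw [hN, ← Matrix.mulVec_mulVec, ← Matrix.mulVec_mulVec, Matrix.dotProduct_mulVec,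
          Matrix.vecMul_transpose]
      rw [h2]
      have := mul_nonneg hσ0 (hdp (R.mulVec y))
      linarith)
    simpa using this
  have hHΘ : Hᵀ * H + Θᵀ * Θ = 1 := by
    have h1 : Pᵀ * ((L * Lᵀ + Lp * Lpᵀ) * P) = 1 := by rw [hLL, Matrix.one_mul, hP]
    rw [← h1, hH, hΘ]
    simp only [Matrix.mul_add, Matrix.add_mul, Matrix.transpose_mul, Matrix.transpose_transpose,
      Matrix.mul_assoc]
  have hA1 : ‖1 - μ • A‖ ≤ 1 - μ * (σ * (1 - θ ^ 2)) + μ ^ 2 * x ^ 2 / 2 := by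
    apply norm_one_sub_le A _ x μ hμ _ hAn
    · intro y
      have h1 := hquad (H.mulVec y)
      have h2 : y ⬝ᵥ A.mulVec y = H.mulVec y ⬝ᵥ Sg.mulVec (H.mulVec y) := by
        rw [hA, ← Matrix.mulVec_mulVec, ← Matrix.mulVec_mulVec, Matrix.dotProduct_mulVec,
          Matrix.vecMul_transpose]
      have h3 : y ⬝ᵥ y = H.mulVec y ⬝ᵥ H.mulVec y + Θ.mulVec y ⬝ᵥ Θ.mulVec y := by
        have e1 : y ⬝ᵥ (Hᵀ * H + Θᵀ * Θ).mulVec y = y ⬝ᵥ y := by rw [hHΘ, Matrix.one_mulVec]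
        rw [← e1, Matrix.add_mulVec, dotProduct_add, dot_gram, dot_gram]
      have h4 : Θ.mulVec y ⬝ᵥ Θ.mulVec y ≤ θ ^ 2 * (y ⬝ᵥ y) := by
        rw [← euclNorm_sq, ← euclNorm_sq, ← mul_pow]
        refine pow_le_pow_left₀ (euclNorm_nonneg _) ((euclNorm_mulVec_le Θ y).trans ?_) 2
        gcongr
        exact euclNorm_nonneg y
      have h5 : (1 - θ ^ 2) * (y ⬝ᵥ y) ≤ H.mulVec y ⬝ᵥ H.mulVec y := by linarith
      rw [h2]
      have h6 := mul_le_mul_of_nonneg_left h5 hσ0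
      linarith
    · have : 0 ≤ μ * σ * θ ^ 2 := by positivity
      nlinarith
  have hPP : ∀ B : Matrix r r ℝ, Pᵀ * (P * B) = B := fun B => by
    rw [← Matrix.mul_assoc, hP, Matrix.one_mul]
  have hΛP : Λ * P = 0 := by
    rw [hΛ, Matrix.sub_mul, Matrix.one_mul, Matrix.mul_assoc, hP, Matrix.mul_one, sub_self]
  have hGP : Lpᵀ * (Λ * (G * P)) = - (Θ * A) - N * Θ + Θ * ((Pᵀ * Lt) * (Sg * (Ltᵀ * P)))
      - Lpᵀ * Λ * (E * (Eᵀ * P)) + Lpᵀ * Λ * (Zt * (Ztᵀ * P)) + Lpᵀ * Λ * (D * P) := by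
    have e1 : Lpᵀ * (Λ * (L * (Sg * H))) = - (Θ * A) := by
      have : Lpᵀ * (Λ * (L * (Sg * H))) = (Lpᵀ * L) * (Sg * H) - Θ * ((Lᵀ * P)ᵀ * (Sg * H)) := by
        rw [hΛ, hΘ]
        simp only [Matrix.sub_mul, Matrix.mul_sub, Matrix.one_mul, Matrix.mul_assoc,
          Matrix.transpose_mul, Matrix.transpose_transpose]
      rw [this, hLpL, Matrix.zero_mul, zero_sub]
    have e2 : Lpᵀ * (Λ * (Lt * (Sg * (Ltᵀ * P)))) =
        N * Θ - Θ * ((Pᵀ * Lt) * (Sg * (Ltᵀ * P))) := by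
      have : N * Θ = (Lpᵀ * Lt) * (Sg * (Ltᵀ * P)) := by
        rw [hLtP, hN, hR]
        simp only [Matrix.mul_assoc, Matrix.transpose_mul, Matrix.transpose_transpose]
      rw [this, hΛ, hΘ]
      simp only [Matrix.sub_mul, Matrix.mul_sub, Matrix.one_mul, Matrix.mul_assoc]
    have e3 : ∀ B : Matrix r r ℝ, Lpᵀ * (Λ * (P * B)) = 0 := fun B => by
      rw [← Matrix.mul_assoc Λ, hΛP, Matrix.zero_mul, Matrix.mul_zero]
    have e4 : G * P = L * (Sg * H) - Lt * (Sg * (Ltᵀ * P)) - P * (S * Sᵀ) - E * (Eᵀ * P)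
        + Zt * (Ztᵀ * P) + D * P := by
      rw [hG]
      simp only [Matrix.sub_mul, Matrix.add_mul, Matrix.mul_assoc, hP, Matrix.mul_one, hH]
      abel
    rw [e4]
    simp only [Matrix.mul_sub, Matrix.mul_add]
    rw [e1, e2, e3]
    simp only [Matrix.mul_assoc]
    abel
  have hmain : Lpᵀ * Ps = (1 - μ • N) * (Θ * ((1 - μ • A) * Y)) - μ ^ 2 • (N * (Θ * (A * Y)))
      + μ • ((Θ * A + N * Θ) * (Y - W)) + μ • (Θ * ((Pᵀ * Lt) * (Sg * ((Ltᵀ * P) * W))))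
      - μ • (Lpᵀ * Λ * (E * ((Eᵀ * P) * W))) + μ • (Lpᵀ * Λ * (Zt * ((Ztᵀ * P) * W)))
      + μ • (Lpᵀ * Λ * (D * (P * W))) + Lpᵀ * Λ * (K * W + μ • (G * (K * W))) := by
    have f1 : Lpᵀ * Ps = Θ * Y + Lpᵀ * (Λ * Ps) := by
      rw [hΘ, hY, hΛ, Matrix.sub_mul, Matrix.one_mul, Matrix.mul_sub]
      simp only [Matrix.mul_assoc]
      abel
    have f2 : Lpᵀ * (Λ * Ps) = μ • ((Lpᵀ * (Λ * (G * P))) * W)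
        + Lpᵀ * Λ * (K * W + μ • (G * (K * W))) := by
      have : Lpᵀ * (Λ * (P * W)) = 0 := by
        rw [← Matrix.mul_assoc Λ, hΛP, Matrix.zero_mul, Matrix.mul_zero]
      rw [hF]
      simp only [Matrix.add_mul, Matrix.mul_add, Matrix.smul_mul, Matrix.mul_smul, smul_add,
        Matrix.mul_assoc, this]
      abel
    rw [f1, f2, hGP]
    simp only [Matrix.add_mul, Matrix.sub_mul, Matrix.mul_add, Matrix.mul_sub, Matrix.smul_mul,
      Matrix.mul_smul, smul_add, smul_sub, Matrix.mul_assoc, Matrix.one_mul, Matrix.neg_mul,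
      smul_neg, smul_smul, pow_two]
    abel
  rw [hmain]
  refine nadd (nadd (nadd (nsub (nadd (nadd (nsub ?_ ?_) ?_) ?_) ?_) ?_) ?_) ?_
  · exact nmul hN1 (nmul hθ (nmul hA1 hYn))
  · apply nsmul' (sq_nonneg μ)
    have := nmul hNn (nmul hθ (nmul hAn hYn))
    rwa [mul_one] at this
  · exact nsmul' hμ (nmul (nadd (nmul hθ hAn) (nmul hNn hθ)) hδ)
  · exact nsmul' hμ (nmul hθ (nmul hPLtn (nmul hx (nmul hLtPn hW))))
  · apply nsmul' hμ
    have := nmul hLpΛ (nmul hE (nmul hEPn hW))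
    rwa [one_mul] at this
  · apply nsmul' hμ
    have := nmul hLpΛ (nmul hZ (nmul hτ hW))
    rwa [one_mul] at this
  · apply nsmul' hμ
    have := nmul hLpΛ (nmul hD (nmul (norm_orth P hP) hW))
    rwa [one_mul, one_mul] at this
  · have := nmul hLpΛ (nadd (nmul hK hW) (nsmul' hμ (nmul hg (nmul hK hW))))
    rwa [one_mul] at this

theorem factor_lemma {n r q k : Type*} [Fintype n] [Fintype r] [Fintype q] [Fintype k]
    [DecidableEq n] [DecidableEq r] [DecidableEq q] [DecidableEq k]
    (L P Ps : Matrix n r ℝ) (G : Matrix n n ℝ) (Z Z1 : Matrix n k ℝ)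
    (Qt Qs : Matrix k r ℝ) (Qtp : Matrix k q ℝ) (S Si Ti : Matrix r r ℝ) (C : Matrix r r ℝ) (μ : ℝ)
    (hQ : Qt * Qtᵀ + Qtp * Qtpᵀ = 1) (hZ1 : Z1 = Z + μ • (G * Z))
    (hQs : Lᵀ * Z1 * Qs * Qsᵀ = Lᵀ * Z1) (hM : Z * Qt = P * S) (hPs : Ps = Z1 * Qs * C)
    (hS1 : S * Si = 1)
    (hT2 : (Lᵀ * (P + μ • (G * P))) * Ti = 1) :
    ∃ W : Matrix r r ℝ, Ps =
      (P + (Z * Qtp) * (Si * Ti * (Lᵀ * (Z * Qtp + μ • (G * (Z * Qtp)))))ᵀ * Si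
        + μ • (G * (P + (Z * Qtp) * (Si * Ti * (Lᵀ * (Z * Qtp + μ • (G * (Z * Qtp)))))ᵀ * Si))) * W := by
  have hS2 : Si * S = 1 := mul_eq_one_comm.1 hS1
  set T := Lᵀ * (P + μ • (G * P)) with hT
  set Y := Lᵀ * Z1 with hY
  have hYQt : Y * Qt = T * S := by
    rw [hY, hZ1, hT]
    simp only [Matrix.mul_add, Matrix.add_mul, Matrix.mul_smul, Matrix.smul_mul, Matrix.mul_assoc, hM]
  have hYQtp : Lᵀ * (Z * Qtp + μ • (G * (Z * Qtp))) = Y * Qtp := by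
    rw [hY, hZ1]
    simp only [Matrix.mul_add, Matrix.add_mul, Matrix.mul_smul, Matrix.smul_mul, Matrix.mul_assoc]
  rw [hYQtp]
  set J := (Si * Ti * (Y * Qtp))ᵀ with hJ
  have hJt : Jᵀ = Si * Ti * (Y * Qtp) := by rw [hJ, Matrix.transpose_transpose]
  have hinv : (Y * Qt) * (Si * Ti) = 1 := by
    rw [hYQt, Matrix.mul_assoc, ← Matrix.mul_assoc S, hS1, Matrix.one_mul, hT2]
  have hYJ : Y * Qtp = (Y * Qt) * Jᵀ := by
    rw [hJt, ← Matrix.mul_assoc (Y * Qt), hinv, Matrix.one_mul]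
  have hV : (Y * Qs) * (Qsᵀ * Qt * (Si * Ti)) = 1 := by
    rw [← hinv]
    conv_rhs => rw [← hQs]
    simp only [Matrix.mul_assoc]
  have hV' := mul_eq_one_comm.1 hV
  set Vi := Qsᵀ * Qt * (Si * Ti) with hVi
  have hQsV : Qsᵀ = Vi * Y := by
    rw [← hQs]
    rw [← Matrix.mul_assoc Vi, hV', Matrix.one_mul]
  have hQJ : Qsᵀ * Qtp = Qsᵀ * Qt * Jᵀ := by
    conv_lhs => rw [hQsV, Matrix.mul_assoc, hYJ, ← Matrix.mul_assoc, ← Matrix.mul_assoc, ← hQsV]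
  have hQJ' : Qtpᵀ * Qs = J * (Qtᵀ * Qs) := by
    have := congrArg Matrix.transpose hQJ
    simpa [Matrix.transpose_mul] using this
  have hQsd : Qs = (Qt + Qtp * J) * (Qtᵀ * Qs) := by
    have : Qs = (Qt * Qtᵀ + Qtp * Qtpᵀ) * Qs := by rw [hQ, Matrix.one_mul]
    conv_lhs => rw [this]
    rw [Matrix.add_mul, Matrix.add_mul, Matrix.mul_assoc, Matrix.mul_assoc, Matrix.mul_assoc, hQJ']
  refine ⟨S * (Qtᵀ * Qs * C), ?_⟩
  have hcan : ∀ B : Matrix r r ℝ, Si * (S * B) = B := fun B => by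
    rw [← Matrix.mul_assoc, hS2, Matrix.one_mul]
  have hM' : ∀ B : Matrix r r ℝ, P * (S * B) = Z * (Qt * B) := fun B => by
    rw [← Matrix.mul_assoc, ← hM, Matrix.mul_assoc]
  rw [hPs]
  conv_lhs => rw [hQsd, hZ1]
  simp only [Matrix.mul_add, Matrix.add_mul, Matrix.mul_smul, Matrix.smul_mul, Matrix.mul_assoc,
    hcan, hM', smul_add]
  try abel

theorem num_K (x σ μ θ e s ζ d q : ℝ) (hx : 0 < x) (hσ : 0 < σ) (hμ : 0 < μ) (hθ : 0 ≤ θ)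
    (he : 0 ≤ e) (hs : 0 < s) (hζ : 0 ≤ ζ) (hd : 0 ≤ d) (hq : 0 < q) (hqx : q ^ 2 = x)
    (hσx : σ ≤ x) (h1 : μ * x ^ 2 ≤ σ / 1000) (h2 : θ * x ≤ σ / 1000) (h5 : e * q ≤ σ / 1000)
    (h5' : e ≤ 2 * s) (h4 : d ≤ σ / 1000) (h6 : ζ ≤ q * s) :
    e * (μ * (2 * q * (θ * e) + μ * (s⁻¹ * (2 * (11 * x * (2 * q * (2 * q * (θ * e))))))
        + s⁻¹ * (2 * (2 * q * ζ + d * e)))) * s⁻¹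
      ≤ μ * σ * θ * (4 / 1000) + (μ * x) ^ 2 + 8 * μ * q * (ζ / s) + 8 * μ * d := by
  set w := e * s⁻¹ with hw
  have hw0 : 0 ≤ w := by positivity
  have hw2 : w ≤ 2 := by
    rw [hw, ← div_eq_mul_inv, div_le_iff₀ hs]; exact h5'
  have hθ1 : θ ≤ 1 / 1000 := by
    by_contra h
    push Not at h
    nlinarith
  have heq : e * (μ * (2 * q * (θ * e) + μ * (s⁻¹ * (2 * (11 * x * (2 * q * (2 * q * (θ * e))))))
        + s⁻¹ * (2 * (2 * q * ζ + d * e)))) * s⁻¹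
      = w * (2 * (μ * θ) * (e * q) + 88 * (μ ^ 2 * x ^ 2 * θ) * w + 4 * (μ * q * (ζ / s))
        + 2 * (μ * d) * w) := by
    rw [hw, ← hqx]; ring
  rw [heq]
  have t1 : 2 * (μ * θ) * (e * q) ≤ 2 * (μ * θ) * (σ / 1000) := by gcongr
  have t2 : 88 * (μ ^ 2 * x ^ 2 * θ) * w ≤ 88 * (μ ^ 2 * x ^ 2 * (1 / 1000)) * 2 := by gcongr
  have t4 : 2 * (μ * d) * w ≤ 2 * (μ * d) * 2 := by gcongr
  have p3 : 0 ≤ 4 * (μ * q * (ζ / s)) := by positivity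
  have hsum : w * (2 * (μ * θ) * (e * q) + 88 * (μ ^ 2 * x ^ 2 * θ) * w + 4 * (μ * q * (ζ / s))
        + 2 * (μ * d) * w) ≤ 2 * (2 * (μ * θ) * (σ / 1000) + 88 * (μ ^ 2 * x ^ 2 * (1 / 1000)) * 2
        + 4 * (μ * q * (ζ / s)) + 2 * (μ * d) * 2) := by
    apply mul_le_mul hw2 (by linarith) (by positivity) (by norm_num)
  nlinarith [sq_nonneg (μ * x)]

theorem num_K_small (x σ μ θ η d q : ℝ) (hx : 0 < x) (hσ : 0 < σ) (hμ : 0 < μ) (hθ : 0 ≤ θ)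
    (hq : 0 < q) (hqx : q ^ 2 = x)
    (hσx : σ ≤ x) (h1 : μ * x ^ 2 ≤ σ / 1000) (h2 : θ * x ≤ σ / 1000)
    (h4 : d ≤ σ / 1000) (h6 : η ≤ q) :
    μ * σ * θ * (4 / 1000) + (μ * x) ^ 2 + 8 * μ * q * η + 8 * μ * d ≤ 9 * (μ * x) ∧
      μ * x ≤ 1 / 1000 ∧ θ ≤ 1 / 1000 := by
  have hθ1 : θ ≤ 1 / 1000 := by
    by_contra h
    push Not at h
    nlinarith
  have hb : μ * x ≤ 1 / 1000 := by
    by_contra h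
    push Not at h
    nlinarith
  have hb0 : 0 < μ * x := by positivity
  refine ⟨?_, hb, hθ1⟩
  have a1 : μ * σ * θ ≤ μ * x * (1 / 1000) := by gcongr
  have a2 : (μ * x) ^ 2 ≤ μ * x * (1 / 1000) := by rw [pow_two]; gcongr
  have a3 : 8 * μ * q * η ≤ 8 * (μ * x) := by
    have : 8 * μ * q * η ≤ 8 * μ * q * q := by gcongr
    rw [← hqx]; linarith
  have a4 : μ * d ≤ μ * (x / 1000) := by gcongr; linarith
  linarith

set_option maxHeartbeats 1000000 in
theorem num_final (x σ μ θ e τ η d q kk : ℝ) (hx : 0 < x) (hσ : 0 < σ) (hμ : 0 < μ) (hθ : 0 ≤ θ)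
    (he : 0 ≤ e) (hτ : 0 ≤ τ) (hη : 0 ≤ η) (hd : 0 ≤ d) (hq : 0 < q) (hqx : q ^ 2 = x)
    (hσx : σ ≤ x) (h2 : θ * x ≤ σ / 1000) (h5 : e * q ≤ σ / 1000)
    (hτq : τ ≤ 2 * q)
    (hb : μ * x ≤ 1 / 1000) (hθ1 : θ ≤ 1 / 1000)
    (hkk : kk = μ * σ * θ * (4 / 1000) + (μ * x) ^ 2 + 8 * μ * q * η + 8 * μ * d) :
    (1 + μ ^ 2 * x ^ 2 / 2) *
        (θ * ((1 - μ * (σ * (1 - θ ^ 2)) + μ ^ 2 * x ^ 2 / 2) * 1))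
      + μ ^ 2 * (x * (θ * x)) + μ * ((θ * x + x * θ) * (22 * (μ * x)))
      + μ * (θ * (θ * (x * (θ * (1 + 22 * (μ * x))))))
      + μ * (e * (θ * e * (1 + 22 * (μ * x)))) + μ * (2 * q * (τ * (1 + 22 * (μ * x))))
      + μ * (d * (1 + 22 * (μ * x)))
      + (kk * (1 + 22 * (μ * x)) + μ * (11 * x * (kk * (1 + 22 * (μ * x)))))
    ≤ (1 - μ * σ / 4) * θ + 2 * μ * q * τ + 1000 * μ * q * η + 1000 * μ * d
      + 1000 * μ ^ 2 * x ^ 2 := by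
  set b := μ * x with hbd
  have hb0 : 0 < b := by positivity
  set u := μ * σ with hu
  have hu0 : 0 < u := by positivity
  have hub : u ≤ b := by rw [hu, hbd]; gcongr
  set ω := 1 + 22 * b with hω
  have hω2 : ω ≤ 103 / 100 := by linarith
  have hω0 : 0 < ω := by linarith
  have e2 : e ^ 2 ≤ σ / 1000000 := by
    have a1 : (e * q) ^ 2 ≤ (σ / 1000) ^ 2 := pow_le_pow_left₀ (by positivity) h5 2
    rw [mul_pow, hqx] at a1
    by_contra h
    push Not at h
    nlinarith
  have b2 : b ^ 2 ≤ 1 / 1000000 := by nlinarith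
  have hkk0 : 0 ≤ kk := by rw [hkk]; positivity
  have huθ : 0 ≤ u * θ := by positivity
  -- main term
  have m1 : (1 + μ ^ 2 * x ^ 2 / 2) *
        (θ * ((1 - μ * (σ * (1 - θ ^ 2)) + μ ^ 2 * x ^ 2 / 2) * 1))
      ≤ θ - u * θ * (99 / 100) + 2 * b ^ 2 := by
    have e1 : μ ^ 2 * x ^ 2 = b ^ 2 := by rw [hbd]; ring
    have e3 : μ * (σ * (1 - θ ^ 2)) = u * (1 - θ ^ 2) := by rw [hu]; ring
    rw [e1, e3]
    have a1 : θ ^ 2 ≤ 1 / 1000 := by nlinarith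
    have a2 : u * θ ^ 2 ≤ u * (1 / 1000) := by gcongr
    have a3 : (1 + b ^ 2 / 2) * (1 - u * (1 - θ ^ 2) + b ^ 2 / 2) ≤ 1 - u * (99 / 100) + 2 * b ^ 2 := by
      have a4 : 1 - u * (1 - θ ^ 2) + b ^ 2 / 2 ≤ 1 - u * (999 / 1000) + b ^ 2 / 2 := by linarith
      have a5 : (1 + b ^ 2 / 2) * (1 - u * (1 - θ ^ 2) + b ^ 2 / 2) ≤
        (1 + b ^ 2 / 2) * (1 - u * (999 / 1000) + b ^ 2 / 2) := by gcongr
      have a6 : 0 ≤ u * b ^ 2 := by positivity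
      have a7 : b ^ 2 * b ^ 2 ≤ b ^ 2 * 1 := by gcongr; linarith
      nlinarith
    have a8 := mul_le_mul_of_nonneg_left a3 hθ
    have a9 : b ^ 2 * θ ≤ b ^ 2 * 1 := by gcongr; linarith
    nlinarith
  have m2 : μ ^ 2 * (x * (θ * x)) ≤ b ^ 2 := by
    have : μ ^ 2 * (x * (θ * x)) = b ^ 2 * θ := by rw [hbd]; ring
    rw [this]
    have a9 : b ^ 2 * θ ≤ b ^ 2 * 1 := by gcongr; linarith
    linarith
  have m3 : μ * ((θ * x + x * θ) * (22 * b)) ≤ b ^ 2 := by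
    have : μ * ((θ * x + x * θ) * (22 * b)) = 44 * (b ^ 2 * θ) := by rw [hbd]; ring
    rw [this]
    have a9 : b ^ 2 * θ ≤ b ^ 2 * (1 / 1000) := by gcongr
    nlinarith [sq_nonneg b]
  have m4 : μ * (θ * (θ * (x * (θ * ω)))) ≤ u * θ / 100 := by
    have : μ * (θ * (θ * (x * (θ * ω)))) = (μ * θ) * (θ * x) * (θ * ω) := by ring
    rw [this]
    have a1 : (μ * θ) * (θ * x) * (θ * ω) ≤ (μ * θ) * (σ / 1000) * (1 / 1000 * (103 / 100)) := by
      gcongr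
    have : (μ * θ) * (σ / 1000) * (1 / 1000 * (103 / 100)) = u * θ * (103 / 100000000) := by
      rw [hu]; ring
    linarith
  have m5 : μ * (e * (θ * e * ω)) ≤ u * θ / 100 := by
    have : μ * (e * (θ * e * ω)) = (μ * θ) * e ^ 2 * ω := by ring
    rw [this]
    have a1 : (μ * θ) * e ^ 2 * ω ≤ (μ * θ) * (σ / 1000000) * (103 / 100) := by gcongr
    have : (μ * θ) * (σ / 1000000) * (103 / 100) = u * θ * (103 / 100000000) := by
      rw [hu]; ring
    linarith
  have m6 : μ * (2 * q * (τ * ω)) ≤ 2 * μ * q * τ + 88 * b ^ 2 := by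
    have : μ * (2 * q * (τ * ω)) = 2 * μ * q * τ + 44 * b * (μ * q) * τ := by rw [hω]; ring
    rw [this]
    have a1 : 44 * b * (μ * q) * τ ≤ 44 * b * (μ * q) * (2 * q) := by gcongr
    have : 44 * b * (μ * q) * (2 * q) = 88 * b ^ 2 := by rw [hbd, ← hqx]; ring
    linarith
  have m7 : μ * (d * ω) ≤ 2 * (μ * d) := by
    have : μ * (d * ω) = μ * d * ω := by ring
    rw [this]
    have a1 : μ * d * ω ≤ μ * d * (103 / 100) := by gcongr
    have : 0 ≤ μ * d := by positivity
    linarith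
  have m8 : kk * ω + μ * (11 * x * (kk * ω)) ≤ 2 * kk := by
    have : kk * ω + μ * (11 * x * (kk * ω)) = kk * (ω * (1 + 11 * b)) := by rw [hbd]; ring
    rw [this]
    have a0 : 1 + 11 * b ≤ 102 / 100 := by linarith
    have a1 : ω * (1 + 11 * b) ≤ (103 / 100) * (102 / 100) := by gcongr
    have a2 : ω * (1 + 11 * b) ≤ 2 := by linarith
    have a3 := mul_le_mul_of_nonneg_left a2 hkk0
    linarith
  have e4 : 1000 * μ ^ 2 * x ^ 2 = 1000 * b ^ 2 := by rw [hbd]; ring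
  have e5 : (1 - u / 4) * θ = θ - u * θ / 4 := by ring
  have p1 : 0 ≤ μ * q * η := by positivity
  have p2 : 0 ≤ μ * d := by positivity
  rw [e4, e5]
  have p3 := sq_nonneg b
  linarith

set_option maxHeartbeats 2000000 in
theorem angle_core {n r p q' k : Type*} [Fintype n] [Fintype r] [Fintype p] [Fintype q'] [Fintype k]
    [DecidableEq n] [DecidableEq r] [DecidableEq p] [DecidableEq q'] [DecidableEq k]
    (L Lt P Ps : Matrix n r ℝ) (Lp : Matrix n p ℝ) (G D : Matrix n n ℝ)
    (Z Z1 Zt : Matrix n k ℝ) (Qt Qs : Matrix k r ℝ) (Qtp : Matrix k q' ℝ)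
    (C Si : Matrix r r ℝ) (sv : r → ℝ)
    (hL : Lᵀ * L = 1) (hLL : L * Lᵀ + Lp * Lpᵀ = 1) (hP : Pᵀ * P = 1)
    (hLp : Lpᵀ * Lp = 1) (hLtt : Ltᵀ * Lt = 1)
    (hLLt : Lᵀ * Lt = 0) (hLLp : Lᵀ * Lp = 0)
    (hQt1 : Qtᵀ * Qt = 1) (hQtp2 : Qtᵀ * Qtp = 0)
    (hQ : Qt * Qtᵀ + Qtp * Qtpᵀ = 1) (hQt : Lᵀ * Z * Qt * Qtᵀ = Lᵀ * Z)
    (hQs : Lᵀ * Z1 * Qs * Qsᵀ = Lᵀ * Z1)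
    (hPM : P * Pᵀ * (Z * Qt) = Z * Qt) (hPs1 : Psᵀ * Ps = 1) (hPs : Ps = Z1 * Qs * C)
    (hSi : Pᵀ * (Z * Qt) * Si = 1)
    (x σ μ q s : ℝ) (hx : 0 < x) (hσ : 0 < σ) (hμ : 0 < μ) (hs : 0 < s) (hq : 0 < q)
    (hqx : q ^ 2 = x)
    (hσx : σ ≤ x) (hsv : ‖Matrix.diagonal sv‖ ≤ x) (hsvσ : ∀ i, σ ≤ sv i) (hSin : ‖Si‖ ≤ s⁻¹)
    (hG : G = L * Matrix.diagonal sv * Lᵀ - Lt * Matrix.diagonal sv * Ltᵀ - Z * Zᵀ + Zt * Ztᵀ + D)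
    (hZ1 : Z1 = Z + μ • (G * Z))
    (h1 : μ * x ^ 2 ≤ σ / 1000) (h2 : ‖Lpᵀ * P‖ * x ≤ σ / 1000)
    (h3 : ‖Z‖ ≤ 2 * q) (h3' : ‖Zt‖ ≤ 2 * q) (h4 : ‖D‖ ≤ σ / 1000)
    (h5 : ‖Z * Qtp‖ * q ≤ σ / 1000) (h5' : ‖Z * Qtp‖ ≤ 2 * s)
    (h6 : ‖Ztᵀ * Z * Qtp‖ ≤ q * s) :
    ‖Lpᵀ * Ps‖ ≤ (1 - μ * σ / 4) * ‖Lpᵀ * P‖ + 2 * μ * q * ‖Ztᵀ * P‖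
      + 1000 * μ * q * (‖Ztᵀ * Z * Qtp‖ / s) + 1000 * μ * ‖D‖ + 1000 * μ ^ 2 * x ^ 2 := by
  rw [Matrix.mul_assoc] at h6 ⊢
  set E := Z * Qtp with hE
  set S := Pᵀ * (Z * Qt) with hS
  set θ := ‖Lpᵀ * P‖ with hθ
  have hM : Z * Qt = P * S := by rw [hS, ← Matrix.mul_assoc, hPM]
  have hSiS : Si * S = 1 := mul_eq_one_comm.1 hSi
  have hLE : Lᵀ * E = 0 := by
    rw [hE, ← Matrix.mul_assoc, ← hQt, Matrix.mul_assoc, hQtp2, Matrix.mul_zero]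
  have hZZ : Z * Zᵀ = P * S * Sᵀ * Pᵀ + E * Eᵀ := by
    have e1 : Z * Zᵀ = Z * (Qt * Qtᵀ + Qtp * Qtpᵀ) * Zᵀ := by rw [hQ, Matrix.mul_one]
    have e2 : P * S * Sᵀ * Pᵀ = (Z * Qt) * (Z * Qt)ᵀ := by
      rw [hM]; simp only [Matrix.transpose_mul, Matrix.mul_assoc]
    rw [e1, e2, hE]
    simp only [Matrix.transpose_mul, Matrix.mul_assoc, Matrix.mul_add, Matrix.add_mul]
  have hG' := hG
  rw [hZZ] at hG'
  have hSn : ‖S‖ ≤ 2 * q := by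
    have := nmul (norm_orth_tr P hP) (nmul h3 (norm_orth Qt hQt1))
    rwa [one_mul, mul_one] at this
  have hgn : ‖G‖ ≤ 11 * x := by
    rw [hG]
    have a := nadd (nadd (nsub (nsub (nmul (nmul (norm_orth L hL) hsv) (norm_orth_tr L hL))
      (nmul (nmul (norm_orth Lt hLtt) hsv) (norm_orth_tr Lt hLtt))) (nmul h3 (ntr h3)))
      (nmul h3' (ntr h3'))) h4
    refine a.trans ?_
    rw [← hqx] at hσx ⊢
    linarith
  obtain ⟨hks, hb, hθ1⟩ := num_K_small x σ μ θ (‖Ztᵀ * E‖ / s) ‖D‖ q hx hσ hμ (norm_nonneg _) hq hqx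
    hσx h1 h2 h4 (by rw [div_le_iff₀ hs]; exact h6)
  have hθ0 : 0 ≤ θ := norm_nonneg _
  obtain ⟨Ti, hT1, hT2, hTn⟩ := T_inv L P Lp G hL hLL hP μ (11 * x) θ hμ.le hgn le_rfl
    (by nlinarith)
  obtain ⟨W, hW⟩ := factor_lemma L P Ps G Z Z1 Qt Qs Qtp S Si Ti C μ hQ hZ1 hQs hM hPs hSi hT2
  have hJ := J_bound L Lt P Lp G D E Zt (Matrix.diagonal sv) S Si Ti hL hLL hP hLp hLLt hLE hSiS
    μ (11 * x) θ ‖E‖ ‖D‖ (2 * q) ‖Ztᵀ * E‖ (2 * q) s⁻¹ hμ.le hgn le_rfl le_rfl le_rfl h3' le_rfl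
    hSn hSin hG' hT1 hTn
  set J := (Si * Ti * (Lᵀ * (E + μ • (G * E))))ᵀ with hJdef
  have hKn : ‖E * J * Si‖ ≤ _ := nmul (nmul (le_refl ‖E‖) hJ) hSin
  replace hKn := hKn.trans (num_K x σ μ θ ‖E‖ s ‖Ztᵀ * E‖ ‖D‖ q hx hσ hμ hθ0 (norm_nonneg _) hs
    (norm_nonneg _) (norm_nonneg _) hq hqx hσx h1 h2 h5 h5' h4 h6)
  set K := E * J * Si with hK
  set kk := μ * σ * θ * (4 / 1000) + (μ * x) ^ 2 + 8 * μ * q * (‖Ztᵀ * E‖ / s) + 8 * μ * ‖D‖ with hkk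
  have hPsn := norm_orth Ps hPs1
  have hb0 : 0 < μ * x := by positivity
  have hPn := norm_orth P hP
  have hK9 : ‖K‖ ≤ 9 * (μ * x) := hKn.trans hks
  have hdiff : Pᵀ * Ps - W = Pᵀ * ((K + μ • (G * (P + K))) * W) := by
    rw [hW]
    have : Pᵀ * (P * W) = W := by rw [← Matrix.mul_assoc, hP, Matrix.one_mul]
    rw [add_assoc, Matrix.add_mul, Matrix.mul_add, this]
    abel
  have hFP : ‖K + μ • (G * (P + K))‖ ≤ 21 * (μ * x) := by
    have := nadd hK9 (nsmul' hμ.le (nmul hgn (nadd hPn hK9)))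
    refine this.trans ?_
    nlinarith
  have hdn : ‖Pᵀ * Ps - W‖ ≤ 21 * (μ * x) * ‖W‖ := by
    rw [hdiff]
    have := nmul (norm_orth_tr P hP) (nmul hFP (le_refl ‖W‖))
    rwa [one_mul] at this
  have hWn : ‖W‖ ≤ 1 + 22 * (μ * x) := by
    have a1 : W = Pᵀ * Ps - (Pᵀ * Ps - W) := by abel
    have a2 : ‖W‖ ≤ 1 * 1 + 21 * (μ * x) * ‖W‖ := by
      conv_lhs => rw [a1]
      exact nsub (nmul (norm_orth_tr P hP) hPsn) hdn
    by_contra h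
    push Not at h
    nlinarith
  have hδ : ‖Pᵀ * Ps - W‖ ≤ 22 * (μ * x) := by nlinarith
  have hτ : ‖Ztᵀ * P‖ ≤ 2 * q := by
    have := nmul (ntr h3') hPn
    rwa [mul_one] at this
  have hμσ : μ * σ ≤ 1 := by nlinarith
  have hfin := final_bound L Lt P K Ps Lp G D E Zt S W sv hL hLL hP hLp hLtt hLLt hLLp hLE
    μ (11 * x) θ ‖E‖ ‖D‖ (2 * q) ‖Ztᵀ * P‖ kk (1 + 22 * (μ * x)) (22 * (μ * x)) x σ hμ.le hgn le_rfl
    le_rfl le_rfl h3' le_rfl hKn hWn hδ hPsn hsv hsvσ hσ.le hμσ hG' hW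
  exact hfin.trans (num_final x σ μ θ ‖E‖ ‖Ztᵀ * P‖ (‖Ztᵀ * E‖ / s) ‖D‖ q kk hx hσ hμ hθ0
    (norm_nonneg _) (norm_nonneg _) (by positivity) (norm_nonneg _) hq hqx hσx h2 h5 hτ hb hθ1 hkk)

theorem sqrt2_inv_mul : (Real.sqrt 2)⁻¹ * (Real.sqrt 2)⁻¹ = (1 / 2 : ℝ) := by
  rw [← mul_inv, Real.mul_self_sqrt (by norm_num)]; norm_num

theorem Zstack_mul_tr {a b c d : ℕ} (V : Matrix (Fin a) (Fin c) ℝ) (W : Matrix (Fin b) (Fin c) ℝ)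
    (S : Matrix (Fin c) (Fin d) ℝ)
    (V' : Matrix (Fin a) (Fin d) ℝ) (W' : Matrix (Fin b) (Fin d) ℝ) :
    Zstack V W * S * (Zstack V' W')ᵀ = (1 / 2 : ℝ) •
      Matrix.fromBlocks (V * S * V'ᵀ) (V * S * W'ᵀ) (W * S * V'ᵀ) (W * S * W'ᵀ) := by
  simp only [Zstack, Matrix.transpose_smul, Matrix.smul_mul, Matrix.mul_smul, smul_smul,
    sqrt2_inv_mul, Matrix.transpose_fromRows, Matrix.fromRows_mul]
  rw [← Matrix.fromRows_mul, Matrix.fromRows_mul_fromCols]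

theorem Zstack_tr_mul {a b c d : ℕ} (V : Matrix (Fin a) (Fin c) ℝ) (W : Matrix (Fin b) (Fin c) ℝ)
    (V' : Matrix (Fin a) (Fin d) ℝ) (W' : Matrix (Fin b) (Fin d) ℝ) :
    (Zstack V W)ᵀ * Zstack V' W' = (1 / 2 : ℝ) • (Vᵀ * V' + Wᵀ * W') := by
  simp only [Zstack, Matrix.transpose_smul, Matrix.smul_mul, Matrix.mul_smul, smul_smul,
    sqrt2_inv_mul, Matrix.transpose_fromRows, Matrix.fromCols_mul_fromRows]

theorem symMat_svd {a b c : ℕ} (V : Matrix (Fin a) (Fin c) ℝ) (W : Matrix (Fin b) (Fin c) ℝ)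
    (S : Matrix (Fin c) (Fin c) ℝ) (hS : Sᵀ = S) :
    symMat (V * S * Wᵀ) = Zstack V W * S * (Zstack V W)ᵀ - Zstack V (-W) * S * (Zstack V (-W))ᵀ := by
  rw [Zstack_mul_tr, Zstack_mul_tr, symMat, ← smul_sub]
  have h : (V * S * Wᵀ)ᵀ = W * S * Vᵀ := by
    simp only [Matrix.transpose_mul, Matrix.transpose_transpose, hS, Matrix.mul_assoc]
  rw [h]
  ext i j
  rcases i with i | i <;> rcases j with j | j <;>
    simp [Matrix.neg_mul, Matrix.mul_neg] <;> ring

theorem symMat_gram {a b c : ℕ} (V : Matrix (Fin a) (Fin c) ℝ) (W : Matrix (Fin b) (Fin c) ℝ) :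
    Zstack V W * (Zstack V W)ᵀ - Zstack V (-W) * (Zstack V (-W))ᵀ = symMat (V * Wᵀ) := by
  have := symMat_svd V W 1 Matrix.transpose_one
  simpa only [Matrix.mul_one] using this.symm

theorem minner_Bmat {a b m : ℕ} (A : Fin m → Matrix (Fin a) (Fin b) ℝ) (i : Fin m)
    (Y : Matrix (Fin a) (Fin b) ℝ) :
    minner (Bmat A i) (symMat Y) = 2 * (Real.sqrt 2)⁻¹ * minner (A i) Y := by
  simp only [minner, Bmat, symMat, Fintype.sum_sum_type, Matrix.smul_apply,
    Matrix.fromBlocks_apply₁₁, Matrix.fromBlocks_apply₁₂, Matrix.fromBlocks_apply₂₁,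
    Matrix.fromBlocks_apply₂₂, Matrix.zero_apply, Matrix.transpose_apply, smul_eq_mul, mul_zero,
    Finset.sum_const_zero, zero_add, add_zero]
  rw [Finset.sum_comm (s := (Finset.univ : Finset (Fin b)))]
  simp only [Finset.mul_sum]
  rw [← Finset.sum_add_distrib]
  refine Finset.sum_congr rfl fun i _ => ?_
  rw [← Finset.sum_add_distrib]
  refine Finset.sum_congr rfl fun j _ => ?_
  ring

theorem BstarB_sym {a b m : ℕ} (A : Fin m → Matrix (Fin a) (Fin b) ℝ)
    (Y : Matrix (Fin a) (Fin b) ℝ) : BstarB A (symMat Y) = symMat (AstarA A Y) := by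
  have h : ∀ i, minner (Bmat A i) (symMat Y) • Bmat A i = minner (A i) Y • symMat (A i) := by
    intro i
    rw [minner_Bmat, Bmat, smul_smul, symMat]
    congr 1
    have := sqrt2_inv_mul
    linear_combination 2 * minner (A i) Y * this
  simp only [BstarB, AstarA, h]
  ext i j
  rcases i with i | i <;> rcases j with j | j <;>
    simp [symMat, Matrix.sum_apply]

theorem symMat_mul_Zstack {a b c : ℕ} (Y : Matrix (Fin a) (Fin b) ℝ)
    (V : Matrix (Fin a) (Fin c) ℝ) (W : Matrix (Fin b) (Fin c) ℝ) :
    symMat Y * Zstack V W = Zstack (Y * W) (Yᵀ * V) := by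
  rw [Zstack, Zstack, symMat, Matrix.mul_smul, Matrix.fromBlocks_mul_fromRows]
  simp

theorem Zit_step {a b m k : ℕ} (A : Fin m → Matrix (Fin a) (Fin b) ℝ) (X : Matrix (Fin a) (Fin b) ℝ)
    (μ : ℝ) (V₀ : Matrix (Fin a) (Fin k) ℝ) (W₀ : Matrix (Fin b) (Fin k) ℝ) (t : ℕ) :
    Zit A X μ V₀ W₀ (t + 1) = Zit A X μ V₀ W₀ t + μ • ((symMat X
      - Zit A X μ V₀ W₀ t * (Zit A X μ V₀ W₀ t)ᵀ + Ztil A X μ V₀ W₀ t * (Ztil A X μ V₀ W₀ t)ᵀ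
      + Δit A X μ V₀ W₀ t) * Zit A X μ V₀ W₀ t) := by
  have e1 : symMat X
      - Zit A X μ V₀ W₀ t * (Zit A X μ V₀ W₀ t)ᵀ + Ztil A X μ V₀ W₀ t * (Ztil A X μ V₀ W₀ t)ᵀ
      + Δit A X μ V₀ W₀ t = - BstarB A (Zit A X μ V₀ W₀ t * (Zit A X μ V₀ W₀ t)ᵀ
    - Ztil A X μ V₀ W₀ t * (Ztil A X μ V₀ W₀ t)ᵀ - symMat X) := by
    simp only [Δit]
    abel
  rw [e1]
  simp only [Zit, Ztil]
  rw [symMat_gram]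
  have e2 : ∀ Y : Matrix (Fin a) (Fin b) ℝ, symMat Y - symMat X = symMat (Y - X) := by
    intro Y
    ext i j
    rcases i with i | i <;> rcases j with j | j <;> simp [symMat]
  rw [e2, BstarB_sym, Matrix.neg_mul, symMat_mul_Zstack]
  simp only [iter]
  ext i j
  rcases i with i | i <;> simp [Zstack] <;> ring

theorem Ztil_norm {a b k : ℕ} (V : Matrix (Fin a) (Fin k) ℝ) (W : Matrix (Fin b) (Fin k) ℝ) :
    ‖Zstack V (-W)‖ = ‖Zstack V W‖ := by
  have h1 := norm_tr_mul_self (Zstack V (-W))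
  have h2 := norm_tr_mul_self (Zstack V W)
  rw [Zstack_tr_mul] at h1 h2
  have h3 : Vᵀ * V + (-W)ᵀ * (-W) = Vᵀ * V + Wᵀ * W := by simp
  rw [h3, h2] at h1
  exact (mul_self_inj (norm_nonneg _) (norm_nonneg _)).1 h1.symm

theorem sigmaPos_le {a b c : ℕ} (X : Matrix (Fin a) (Fin b) ℝ)
    (PX : Matrix (Fin a) (Fin c) ℝ) (QX : Matrix (Fin b) (Fin c) ℝ) (σX : Fin c → ℝ)
    (hPX : PXᵀ * PX = 1) (hQX : QXᵀ * QX = 1) (hσpos : ∀ i, 0 < σX i)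
    (hXsvd : X = PX * Matrix.diagonal σX * QXᵀ) (i : Fin c) : sigmaPos X ≤ σX i := by
  have iso : ∀ {d : ℕ} (U : Matrix (Fin d) (Fin c) ℝ) (y : Fin c → ℝ), Uᵀ * U = 1 →
      euclNorm (U.mulVec y) = euclNorm y := by
    intro d U y hU
    have h1 := dot_gram U y
    rw [hU, Matrix.one_mulVec, ← euclNorm_sq, ← euclNorm_sq] at h1
    exact ((sq_eq_sq₀ (euclNorm_nonneg _) (euclNorm_nonneg _)).1 h1).symm
  have hsingle : ∀ s : ℝ, euclNorm (Pi.single i s) = |s| := by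
    intro s
    have h1 := euclNorm_sq (Pi.single i s : Fin c → ℝ)
    rw [dotProduct_single, Pi.single_eq_same, ← sq, ← sq_abs s] at h1
    exact (sq_eq_sq₀ (euclNorm_nonneg _) (abs_nonneg _)).1 h1
  apply csInf_le
  · exact ⟨0, by rintro c ⟨x, -, -, rfl⟩; exact euclNorm_nonneg _⟩
  refine ⟨QX.mulVec (Pi.single i 1), ?_, ?_, ?_⟩
  · rw [iso _ _ hQX, hsingle, abs_one]
  · intro y hy
    have h1 : Matrix.diagonal σX *ᵥ (QXᵀ *ᵥ y) = 0 := by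
      have : PXᵀ *ᵥ (X *ᵥ y) = 0 := by rw [hy, Matrix.mulVec_zero]
      rw [hXsvd, Matrix.mulVec_mulVec, Matrix.mul_assoc, ← Matrix.mul_assoc, hPX,
        Matrix.one_mul, ← Matrix.mulVec_mulVec] at this
      exact this
    have h2 : QXᵀ *ᵥ y = 0 := by
      funext j
      have := congrFun h1 j
      rw [Matrix.mulVec_diagonal] at this
      simpa [(hσpos j).ne'] using this
    rw [dotProduct_comm, Matrix.dotProduct_mulVec, ← Matrix.mulVec_transpose, h2, zero_dotProduct]
  · have : X.mulVec (QX.mulVec (Pi.single i 1)) = PX.mulVec (Pi.single i (σX i)) := by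
      rw [hXsvd, Matrix.mulVec_mulVec, Matrix.mul_assoc, hQX, Matrix.mul_one,
        ← Matrix.mulVec_mulVec]
      congr 1
      funext j
      rw [Matrix.mulVec_diagonal]
      by_cases h : j = i
      · subst h; simp
      · simp [h]
    rw [this, iso _ _ hPX, hsingle, abs_of_pos (hσpos i)]

theorem diag_norm_le {a b c : ℕ} (X : Matrix (Fin a) (Fin b) ℝ)
    (PX : Matrix (Fin a) (Fin c) ℝ) (QX : Matrix (Fin b) (Fin c) ℝ) (σX : Fin c → ℝ)
    (hPX : PXᵀ * PX = 1) (hQX : QXᵀ * QX = 1)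
    (hXsvd : X = PX * Matrix.diagonal σX * QXᵀ) : ‖Matrix.diagonal σX‖ ≤ ‖X‖ := by
  have h1 : Matrix.diagonal σX = PXᵀ * (X * QX) := by
    rw [hXsvd, Matrix.mul_assoc, Matrix.mul_assoc, hQX, Matrix.mul_one, ← Matrix.mul_assoc, hPX,
      Matrix.one_mul]
  rw [h1]
  have := nmul (norm_orth_tr PX hPX) (nmul (le_refl ‖X‖) (norm_orth QX hQX))
  linarith

/-- properties of the smallest singular value of a tall matrix with a left inverse -/
theorem sigmaMin_tall {ι : Type*} [Fintype ι] [DecidableEq ι] {c : ℕ} (M : Matrix ι (Fin c) ℝ)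
    (B : Matrix (Fin c) ι ℝ) (hB : B * M = 1) (hc : 0 < c) (hlt : c < Fintype.card ι) :
    0 < sigmaMin M ∧ ∀ y, sigmaMin M * euclNorm y ≤ euclNorm (M.mulVec y) := by
  have hrow : sInf {c : ℝ | ∃ y : ι → ℝ, euclNorm y = 1 ∧ c = euclNorm (Mᵀ.mulVec y)} ≤ 0 := by
    have hex : ∃ y : ι → ℝ, y ≠ 0 ∧ Mᵀ.mulVec y = 0 := by
      by_contra hcon
      push Not at hcon
      have hinj : Function.Injective (Matrix.mulVecLin Mᵀ) := by
        rw [injective_iff_map_eq_zero]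
        intro y hy
        by_contra hy0
        exact hcon y hy0 hy
      have := LinearMap.finrank_le_finrank_of_injective hinj
      simp at this
      omega
    obtain ⟨y, hy0, hy⟩ := hex
    have hpos : 0 < euclNorm y :=
      lt_of_le_of_ne (euclNorm_nonneg y) (fun h => hy0 (euclNorm_eq_zero h.symm))
    apply csInf_le
    · exact ⟨0, by rintro c ⟨x, -, rfl⟩; exact euclNorm_nonneg _⟩
    · refine ⟨(euclNorm y)⁻¹ • y, ?_, ?_⟩
      · rw [euclNorm_smul, abs_of_pos (inv_pos.2 hpos), inv_mul_cancel₀ hpos.ne']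
      · rw [Matrix.mulVec_smul, hy, smul_zero, euclNorm_zero]
  set T := {c : ℝ | ∃ x : Fin _ → ℝ, euclNorm x = 1 ∧ c = euclNorm (M.mulVec x)} with hT
  have hBx : ∀ x : Fin c → ℝ, euclNorm x ≤ ‖B‖ * euclNorm (M.mulVec x) := by
    intro x
    have := euclNorm_mulVec_le B (M.mulVec x)
    rwa [Matrix.mulVec_mulVec, hB, Matrix.one_mulVec] at this
  have hne : T.Nonempty := by
    refine ⟨_, Pi.single ⟨0, hc⟩ 1, ?_, rfl⟩
    have h1 := euclNorm_sq (Pi.single (⟨0, hc⟩ : Fin c) (1 : ℝ))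
    rw [dotProduct_single, Pi.single_eq_same, ← sq] at h1
    exact (sq_eq_sq₀ (euclNorm_nonneg _) zero_le_one).1 h1
  have hBpos : 0 < ‖B‖ := by
    obtain ⟨_, x, hx, -⟩ := hne
    have := hBx x
    rw [hx] at this
    by_contra h
    have h0 : ‖B‖ = 0 := le_antisymm (not_lt.1 h) (norm_nonneg _)
    rw [h0, zero_mul] at this
    linarith
  have hlow : 0 < sInf T := by
    refine lt_of_lt_of_le (inv_pos.2 hBpos) (le_csInf hne ?_)
    rintro _ ⟨x, hx, rfl⟩
    have := hBx x
    rw [hx] at this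
    rw [inv_le_iff_one_le_mul₀ hBpos]
    linarith
  have hsm : sigmaMin M = sInf T := by
    rw [sigmaMin]
    exact max_eq_left (hrow.trans hlow.le)
  rw [hsm]
  refine ⟨hlow, fun y => ?_⟩
  by_cases hy : euclNorm y = 0
  · rw [hy, mul_zero]; exact euclNorm_nonneg _
  · have hpos : 0 < euclNorm y := lt_of_le_of_ne (euclNorm_nonneg y) (Ne.symm hy)
    have h1 : sInf T ≤ euclNorm (M.mulVec ((euclNorm y)⁻¹ • y)) := by
      apply csInf_le
      · exact ⟨0, by rintro c ⟨x, -, rfl⟩; exact euclNorm_nonneg _⟩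
      · refine ⟨_, ?_, rfl⟩
        rw [euclNorm_smul, abs_of_pos (inv_pos.2 hpos), inv_mul_cancel₀ hy]
    rw [Matrix.mulVec_smul, euclNorm_smul, abs_of_pos (inv_pos.2 hpos), le_inv_mul_iff₀ hpos] at h1
    linarith

set_option maxHeartbeats 1000000 in
theorem angle_main (n₁ n₂ m k r : ℕ)
    (A : Fin m → Matrix (Fin n₁) (Fin n₂) ℝ) (X : Matrix (Fin n₁) (Fin n₂) ℝ)
    (PX : Matrix (Fin n₁) (Fin r) ℝ) (QX : Matrix (Fin n₂) (Fin r) ℝ) (σX : Fin r → ℝ)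
    (hPX : PXᵀ * PX = 1) (hQX : QXᵀ * QX = 1)
    (hσpos : ∀ i, 0 < σX i) (hσanti : Antitone σX)
    (hXsvd : X = PX * Matrix.diagonal σX * QXᵀ)
    (μ : ℝ) (hμ : 0 < μ)
    (V₀ : Matrix (Fin n₁) (Fin k) ℝ) (W₀ : Matrix (Fin n₂) (Fin k) ℝ)
    (Z Z' : ℕ → Matrix (Fin n₁ ⊕ Fin n₂) (Fin k) ℝ)
    (hZ : Z = Zit A X μ V₀ W₀) (hZ' : Z' = Ztil A X μ V₀ W₀)
    (LX : Matrix (Fin n₁ ⊕ Fin n₂) (Fin r) ℝ) (hLX : LX = Zstack PX QX)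
    (κ σm : ℝ) (hκ : κ = condNum X) (hσm : σm = sigmaPos X)
    (Δ : ℕ → Matrix (Fin n₁ ⊕ Fin n₂) (Fin n₁ ⊕ Fin n₂) ℝ) (hΔ : Δ = Δit A X μ V₀ W₀)
    (LXp : Matrix (Fin n₁ ⊕ Fin n₂) (Fin (n₁ + n₂ - r)) ℝ)
    (hLXp1 : LXpᵀ * LXp = 1) (hLXp2 : LXᵀ * LXp = 0)
    (t : ℕ)
    (Qt : Matrix (Fin k) (Fin r) ℝ) (hQt1 : Qtᵀ * Qt = 1)
    (hQt2 : LXᵀ * Z t * Qt * Qtᵀ = LXᵀ * Z t)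
    (Qtp : Matrix (Fin k) (Fin (k - r)) ℝ) (hQtp1 : Qtpᵀ * Qtp = 1) (hQtp2 : Qtᵀ * Qtp = 0)
    (Qs : Matrix (Fin k) (Fin r) ℝ) (hQs1 : Qsᵀ * Qs = 1)
    (hQs2 : LXᵀ * Z (t + 1) * Qs * Qsᵀ = LXᵀ * Z (t + 1))
    (PZ : Matrix (Fin n₁ ⊕ Fin n₂) (Fin r) ℝ) (hPZ : IsOrthCol PZ (Z t * Qt))
    (PZs : Matrix (Fin n₁ ⊕ Fin n₂) (Fin r) ℝ) (hPZs : IsOrthCol PZs (Z (t + 1) * Qs))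
    (h1 : μ ≤ (1 / 1000) / (specNorm X * κ))
    (h2 : specNorm (LXpᵀ * PZ) ≤ (1 / 1000) / κ)
    (h3 : specNorm (Z t) ≤ 2 * Real.sqrt (specNorm X))
    (h4 : specNorm (Δ t) ≤ (1 / 1000) * σm)
    (h5 : specNorm (Z t * Qtp)
      ≤ min ((1 / 1000) * κ ^ (-(1 : ℝ) / 2) * Real.sqrt σm) (2 * sigmaMin (Z t * Qt)))
    (h6 : specNorm ((Z' t)ᵀ * Z t * Qtp) ≤ Real.sqrt (specNorm X) * sigmaMin (Z t * Qt))
    (h7 : (Z t * Qt).rank = r) :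
    specNorm (LXpᵀ * PZs)
      ≤ (1 - μ * σm / 4) * specNorm (LXpᵀ * PZ)
        + 2 * μ * Real.sqrt (specNorm X) * specNorm ((Z' t)ᵀ * PZ)
        + 1000 * μ * Real.sqrt (specNorm X) * specNorm ((Z' t)ᵀ * Z t * Qtp) / sigmaMin (Z t * Qt)
        + 1000 * μ * specNorm (Δ t) + 1000 * μ ^ 2 * specNorm X ^ 2 := by
  simp only [specNorm_eq] at h1 h2 h3 h4 h5 h6 ⊢
  obtain ⟨hP1, ⟨Si, hSi⟩, hP2⟩ := hPZ
  obtain ⟨hPs1, ⟨C, hC⟩, -⟩ := hPZs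
  -- positivity of the basic quantities
  have hσm0 : 0 ≤ σm := by
    rw [hσm]
    apply Real.sInf_nonneg
    rintro c ⟨x, -, -, rfl⟩
    exact euclNorm_nonneg _
  have hκe : κ = ‖X‖ / σm := by rw [hκ, hσm, condNum, specNorm_eq]
  have hσ : 0 < σm := by
    rcases hσm0.lt_or_eq with h | h
    · exact h
    · exfalso
      rw [hκe, ← h] at h1
      simp at h1
      linarith
  have hx : 0 < ‖X‖ := by
    rcases (norm_nonneg X).lt_or_eq with h | h
    · exact h
    · exfalso
      rw [← h] at h1
      simp at h1
      linarith
  have hr : 0 < r := by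
    rcases Nat.eq_zero_or_pos r with h | h
    · exfalso
      subst h
      have : X = 0 := by
        rw [hXsvd]
        ext i j
        simp [Matrix.mul_apply]
      rw [this, norm_zero] at hx
      exact lt_irrefl _ hx
    · exact h
  have hsvσ : ∀ i, σm ≤ σX i := by
    intro i
    rw [hσm]
    exact sigmaPos_le X PX QX σX hPX hQX hσpos hXsvd i
  have hsv : ‖Matrix.diagonal σX‖ ≤ ‖X‖ := diag_norm_le X PX QX σX hPX hQX hXsvd
  have hσx : σm ≤ ‖X‖ := by
    refine (hsvσ ⟨0, hr⟩).trans (le_trans ?_ hsv)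
    rw [Matrix.l2_opNorm_diagonal]
    exact (le_abs_self _).trans (norm_le_pi_norm σX ⟨0, hr⟩)
  -- dimension counts
  have hrn1 : r ≤ n₁ := by simpa using card_le_of_orth PX hPX
  have hrn2 : r ≤ n₂ := by simpa using card_le_of_orth QX hQX
  have hrk : r ≤ k := by simpa using card_le_of_orth Qt hQt1
  -- orthonormality relations
  have hL : LXᵀ * LX = 1 := by
    rw [hLX, Zstack_tr_mul, hPX, hQX, ← two_smul ℝ, smul_smul]
    norm_num
  have hLtt : (Zstack PX (-QX))ᵀ * Zstack PX (-QX) = 1 := by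
    rw [Zstack_tr_mul, Matrix.transpose_neg, Matrix.neg_mul, Matrix.mul_neg, neg_neg, hPX, hQX, ← two_smul ℝ, smul_smul]
    norm_num
  have hLLt : LXᵀ * Zstack PX (-QX) = 0 := by
    rw [hLX, Zstack_tr_mul, Matrix.mul_neg, hPX, hQX]
    simp
  have hLL : LX * LXᵀ + LXp * LXpᵀ = 1 := by
    refine complete_of_card LX LXp hL hLXp1 hLXp2 ?_
    simp
    omega
  have hQ : Qt * Qtᵀ + Qtp * Qtpᵀ = 1 := by
    refine complete_of_card Qt Qtp hQt1 hQtp1 hQtp2 ?_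
    simp
    omega
  -- the smallest singular value
  have hSS : PZᵀ * (Z t * Qt) * Si = 1 := by
    rw [Matrix.mul_assoc, ← hSi, hP1]
  have hSiM : (Si * PZᵀ) * (Z t * Qt) = 1 := by
    rw [Matrix.mul_assoc]
    exact mul_eq_one_comm.1 hSS
  obtain ⟨hs, hsy⟩ := sigmaMin_tall (Z t * Qt) (Si * PZᵀ) hSiM hr (by simp; omega)
  set s := sigmaMin (Z t * Qt) with hsdef
  have hSin : ‖Si‖ ≤ s⁻¹ := by
    apply norm_le_of_vec _ _ (inv_nonneg.2 hs.le)
    intro y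
    have e1 := hsy (Si.mulVec y)
    rw [Matrix.mulVec_mulVec, ← hSi] at e1
    have e2 := euclNorm_mulVec_le PZ y
    have e3 := norm_orth PZ hP1
    have e4 : euclNorm (PZ.mulVec y) ≤ euclNorm y := by nlinarith [euclNorm_nonneg y]
    rw [le_inv_mul_iff₀ hs]
    linarith
  set q := Real.sqrt ‖X‖ with hq
  have hq0 : 0 < q := Real.sqrt_pos.2 hx
  have hqx : q ^ 2 = ‖X‖ := Real.sq_sqrt hx.le
  have hκ0 : 0 < κ := by rw [hκe]; positivity
  have g1 : μ * ‖X‖ ^ 2 ≤ σm / 1000 := by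
    rw [le_div_iff₀ (by positivity), hκe] at h1
    have e : μ * ‖X‖ ^ 2 = μ * (‖X‖ * (‖X‖ / σm)) * σm := by field_simp
    rw [e]
    have := mul_le_mul_of_nonneg_right h1 hσ.le
    linarith
  have g2 : ‖LXpᵀ * PZ‖ * ‖X‖ ≤ σm / 1000 := by
    rw [le_div_iff₀ hκ0, hκe] at h2
    have e : ‖LXpᵀ * PZ‖ * ‖X‖ = ‖LXpᵀ * PZ‖ * (‖X‖ / σm) * σm := by field_simp
    rw [e]
    have := mul_le_mul_of_nonneg_right h2 hσ.le
    linarith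
  obtain ⟨h5a, h5b⟩ := le_min_iff.1 h5
  have g5 : ‖Z t * Qtp‖ * q ≤ σm / 1000 := by
    have e1 : κ ^ (-(1 : ℝ) / 2) = Real.sqrt σm / q := by
      rw [neg_div, Real.rpow_neg hκ0.le, ← Real.sqrt_eq_rpow, hκe, Real.sqrt_div hx.le, inv_div]
    rw [e1] at h5a
    have e2 : (1 / 1000 * (Real.sqrt σm / q) * Real.sqrt σm) * q = σm / 1000 := by
      have := Real.mul_self_sqrt hσ.le
      field_simp
      nlinarith
    rw [← e2]
    gcongr
  have hZt : ‖Z' t‖ ≤ 2 * q := by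
    have : ‖Z' t‖ = ‖Z t‖ := by rw [hZ', hZ]; exact Ztil_norm _ _
    rw [this]; exact h3
  have hsym : symMat X = LX * Matrix.diagonal σX * LXᵀ
      - Zstack PX (-QX) * Matrix.diagonal σX * (Zstack PX (-QX))ᵀ := by
    rw [hXsvd, hLX]
    exact symMat_svd PX QX _ (Matrix.diagonal_transpose _)
  have hstep : Z (t + 1) = Z t + μ • ((symMat X - Z t * (Z t)ᵀ + Z' t * (Z' t)ᵀ + Δ t) * Z t) := by
    rw [hZ, hZ', hΔ]
    exact Zit_step A X μ V₀ W₀ t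
  have key := angle_core LX (Zstack PX (-QX)) PZ PZs LXp
    (symMat X - Z t * (Z t)ᵀ + Z' t * (Z' t)ᵀ + Δ t) (Δ t) (Z t) (Z (t + 1)) (Z' t) Qt Qs Qtp C Si σX
    hL hLL hP1 hLXp1 hLtt hLLt hLXp2 hQt1 hQtp2 hQ hQt2 hQs2 hP2 hPs1 hC hSS ‖X‖ σm μ q s hx hσ hμ
    hs hq0 hqx hσx hsv hsvσ hSin (by rw [hsym]) hstep g1 g2 h3 hZt (by linarith) g5 h5b h6
  exact key.trans (le_of_eq (by ring))

end helpers

/-- control of the angle `‖L_{X,⊥}ᵀP_{Z_tQ_t}‖`. -/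
theorem statement11_angle_control :
    ∃ c C : ℝ, 0 < c ∧ 0 < C ∧
    ∀
    (n₁ n₂ m k r : ℕ)
    (A : Fin m → Matrix (Fin n₁) (Fin n₂) ℝ) (X : Matrix (Fin n₁) (Fin n₂) ℝ)
    (PX : Matrix (Fin n₁) (Fin r) ℝ) (QX : Matrix (Fin n₂) (Fin r) ℝ) (σX : Fin r → ℝ)
    (hPX : PXᵀ * PX = 1) (hQX : QXᵀ * QX = 1)
    (hσpos : ∀ i, 0 < σX i) (hσanti : Antitone σX)
    (hXsvd : X = PX * Matrix.diagonal σX * QXᵀ)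
    (μ : ℝ) (hμ : 0 < μ)
    (V₀ : Matrix (Fin n₁) (Fin k) ℝ) (W₀ : Matrix (Fin n₂) (Fin k) ℝ)
    (Z Z' : ℕ → Matrix (Fin n₁ ⊕ Fin n₂) (Fin k) ℝ)
    (hZ : Z = Zit A X μ V₀ W₀) (hZ' : Z' = Ztil A X μ V₀ W₀)
    (LX : Matrix (Fin n₁ ⊕ Fin n₂) (Fin r) ℝ) (hLX : LX = Zstack PX QX)
    (κ σm : ℝ) (hκ : κ = condNum X) (hσm : σm = sigmaPos X)
    (Δ : ℕ → Matrix (Fin n₁ ⊕ Fin n₂) (Fin n₁ ⊕ Fin n₂) ℝ) (hΔ : Δ = Δit A X μ V₀ W₀)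
    (LXp : Matrix (Fin n₁ ⊕ Fin n₂) (Fin (n₁ + n₂ - r)) ℝ)
    (hLXp1 : LXpᵀ * LXp = 1) (hLXp2 : LXᵀ * LXp = 0)
    (t : ℕ)
    (Qt : Matrix (Fin k) (Fin r) ℝ) (hQt1 : Qtᵀ * Qt = 1)
    (hQt2 : LXᵀ * Z t * Qt * Qtᵀ = LXᵀ * Z t)
    (Qtp : Matrix (Fin k) (Fin (k - r)) ℝ) (hQtp1 : Qtpᵀ * Qtp = 1) (hQtp2 : Qtᵀ * Qtp = 0)
    (Qs : Matrix (Fin k) (Fin r) ℝ) (hQs1 : Qsᵀ * Qs = 1)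
    (hQs2 : LXᵀ * Z (t + 1) * Qs * Qsᵀ = LXᵀ * Z (t + 1))
    (PZ : Matrix (Fin n₁ ⊕ Fin n₂) (Fin r) ℝ) (hPZ : IsOrthCol PZ (Z t * Qt))
    (PZs : Matrix (Fin n₁ ⊕ Fin n₂) (Fin r) ℝ) (hPZs : IsOrthCol PZs (Z (t + 1) * Qs))
    (h1 : μ ≤ c / (specNorm X * κ))
    (h2 : specNorm (LXpᵀ * PZ) ≤ c / κ)
    (h3 : specNorm (Z t) ≤ 2 * Real.sqrt (specNorm X))
    (h4 : specNorm (Δ t) ≤ c * σm)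
    (h5 : specNorm (Z t * Qtp)
      ≤ min (c * κ ^ (-(1 : ℝ) / 2) * Real.sqrt σm) (2 * sigmaMin (Z t * Qt)))
    (h6 : specNorm ((Z' t)ᵀ * Z t * Qtp) ≤ Real.sqrt (specNorm X) * sigmaMin (Z t * Qt))
    (h7 : (Z t * Qt).rank = r),
    specNorm (LXpᵀ * PZs)
      ≤ (1 - μ * σm / 4) * specNorm (LXpᵀ * PZ)
        + 2 * μ * Real.sqrt (specNorm X) * specNorm ((Z' t)ᵀ * PZ)
        + C * μ * Real.sqrt (specNorm X) * specNorm ((Z' t)ᵀ * Z t * Qtp) / sigmaMin (Z t * Qt)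
        + C * μ * specNorm (Δ t) + C * μ ^ 2 * specNorm X ^ 2 := by
  refine ⟨1 / 1000, 1000, by norm_num, by norm_num, ?_⟩
  intro n₁ n₂ m k r A X PX QX σX hPX hQX hσpos hσanti hXsvd μ hμ V₀ W₀ Z Z' hZ hZ' LX hLX κ σm
    hκ hσm Δ hΔ LXp hLXp1 hLXp2 t Qt hQt1 hQt2 Qtp hQtp1 hQtp2 Qs hQs1 hQs2 PZ hPZ PZs hPZs
    h1 h2 h3 h4 h5 h6 h7
  exact angle_main n₁ n₂ m k r A X PX QX σX hPX hQX hσpos hσanti hXsvd μ hμ V₀ W₀ Z Z' hZ hZ' LX hLX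
    κ σm hκ hσm Δ hΔ LXp hLXp1 hLXp2 t Qt hQt1 hQt2 Qtp hQtp1 hQtp2 Qs hQs1 hQs2 PZ hPZ PZs hPZs
    h1 h2 h3 h4 h5 h6 h7

end AsymMatrixSensing
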